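/- Let p be an odd prime, let F be the unramified quadratic extension of the field ℚ_p of p-adic numbers, let G = GL_2(F), and let k be an algebraic closure of F_p. Then there exists a smooth irreducible non-admissible representation V of G over k on which the central element p·Id (the scalar matrix with diagonal entries p, which lies in the center of G) acts trivially, i.e., p·Id acts as the identity map of V. -/

import Mathlib

open Matrix

section Sums

open Polynomial

variable {𝔽 k : Type*} [Field 𝔽] [Fintype 𝔽] [Field k] (φ : 𝔽 →+* k)

theorem sum_pow_map_eq_zero {m : ℕ} (hm : m < Fintype.card 𝔽 - 1) : ∑ x, φ x ^ m = 0 := by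
  have := congrArg φ (FiniteField.sum_pow_lt_card_sub_one 𝔽 m hm)
  simpa using this

theorem sum_pow_map_eq_neg_one : ∑ x, φ x ^ (Fintype.card 𝔽 - 1) = -1 := by
  classical
  have hq : 1 < Fintype.card 𝔽 := Fintype.one_lt_card
  have h : ∀ x : 𝔽, φ x ^ (Fintype.card 𝔽 - 1) = 1 - if x = 0 then 1 else 0 := by
    intro x
    by_cases hx : x = 0
    · subst hx; rw [map_zero, zero_pow (by omega)]; simp
    · rw [← map_pow, FiniteField.pow_card_sub_one_eq_one x hx]; simp [hx]
  simp_rw [h]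
  rw [Finset.sum_sub_distrib]
  simp [← map_natCast φ]

theorem sum_eval_map {P : k[X]} (hP : P.natDegree ≤ Fintype.card 𝔽 - 1) :
    ∑ x, P.eval (φ x) = -P.coeff (Fintype.card 𝔽 - 1) := by
  simp_rw [Polynomial.eval_eq_sum_range' (Nat.lt_succ_of_le hP)]
  rw [Finset.sum_comm, Finset.sum_range_succ, Finset.sum_eq_zero, zero_add, ← Finset.mul_sum,
    sum_pow_map_eq_neg_one, mul_neg_one]
  intro i hi
  rw [← Finset.mul_sum, sum_pow_map_eq_zero φ (Finset.mem_range.1 hi), mul_zero]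

theorem sum_eval_map_eq_zero {P : k[X]} (hP : P.natDegree < Fintype.card 𝔽 - 1) :
    ∑ x, P.eval (φ x) = 0 := by
  rw [sum_eval_map φ hP.le, Polynomial.coeff_eq_zero_of_natDegree_lt hP, neg_zero]

variable {p : ℕ}

theorem sum_pow_mul_linear_eq_zero (hp : 3 ≤ p) (hcard : Fintype.card 𝔽 = p ^ 2)
    {m : ℕ} (hm : m < p) (a b a' b' : k) :
    ∑ x, φ x ^ m * ((a * φ x ^ p + b) * (a' * φ x + b')) ^ (p - 2) = 0 := by
  have h := sum_eval_map_eq_zero φ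
    (P := X ^ m * ((C a * X ^ p + C b) * (C a' * X + C b')) ^ (p - 2)) (by
      have h1 : (X ^ m * ((C a * X ^ p + C b) * (C a' * X + C b')) ^ (p - 2) : k[X]).natDegree ≤
          m + (p - 2) * (p + 1) := by
        compute_degree
      obtain ⟨r, rfl⟩ : ∃ r, p = r + 2 := ⟨p - 2, by omega⟩
      have h2 : r + 2 - 2 = r := by omega
      rw [h2] at h1
      rw [hcard, Nat.lt_sub_iff_add_lt]
      rw [h2]
      nlinarith)
  simpa using h

theorem sum_mul_linear_pow_eq_zero (hp : 3 ≤ p) (hcard : Fintype.card 𝔽 = p ^ 2)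
    (a b : k) :
    ∑ x, φ x * (a * φ x + b) ^ (p - 1) = 0 := by
  have h := sum_eval_map_eq_zero φ (P := X * (C a * X + C b) ^ (p - 1)) (by
      have h1 : (X * (C a * X + C b) ^ (p - 1) : k[X]).natDegree ≤ 1 + (p - 1) := by
        compute_degree
      rw [hcard, Nat.lt_sub_iff_add_lt]
      have : 1 + (p - 1) = p := by omega
      nlinarith)
  simpa using h

theorem sum_mul_pow_mul_pow_mul (hp : 3 ≤ p) (hcard : Fintype.card 𝔽 = p ^ 2)
    {a b c d a' b' : k} [CharP k p] [Fact p.Prime]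
    (ha : a ^ p = a') (hb : b ^ p = b') :
    ∑ x, φ x * ((a * φ x ^ p + b) ^ (p - 1) * ((a' * φ x + b') ^ (p - 2) * (c * φ x ^ p + d))) =
      -((a * a') ^ (p - 2) * (a * d - b * c)) := by
  have hpow : ∀ x : 𝔽, (φ x ^ p) ^ p = φ x := fun x => by
    rw [← pow_mul, ← sq, ← hcard, ← map_pow, FiniteField.pow_card]
  have hone : 1 < p := by omega
  by_cases h0 : a = 0
  · subst h0
    have ha' : a' = 0 := by rw [← ha, zero_pow (by omega)]
    subst ha'
    have h := sum_eval_map_eq_zero φ (P := C (b ^ (p - 1) * b' ^ (p - 2)) * (X * (C c * X ^ p + C d)))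
      (by
      have h1 : (C (b ^ (p - 1) * b' ^ (p - 2)) * (X * (C c * X ^ p + C d)) : k[X]).natDegree ≤
          1 + p := by
        compute_degree
      rw [hcard, Nat.lt_sub_iff_add_lt]
      nlinarith)
    rw [zero_mul, zero_pow (by omega), zero_mul, neg_zero]
    refine (Finset.sum_congr rfl fun x _ => ?_).trans h
    simp
    ring
  · have h1 := sum_mul_linear_pow_eq_zero φ hp hcard a' b'
    set P : k[X] := X * ((C a * X ^ p + C b) ^ (p - 1) * (C a' * X + C b') ^ (p - 2)) with hP
    have e1 : 1 + ((p - 1) * p + (p - 2) * 1) = p ^ 2 - 1 := by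
      obtain ⟨r, rfl⟩ : ∃ r, p = r + 2 := ⟨p - 2, by omega⟩
      have h2 : r + 2 - 2 = r := by omega
      have h3 : r + 2 - 1 = r + 1 := by omega
      rw [h2, h3]
      symm
      apply Nat.sub_eq_of_eq_add
      ring
    have d1 : (C a * X ^ p + C b : k[X]).natDegree ≤ p := by compute_degree
    have d2 : (C a' * X + C b' : k[X]).natDegree ≤ 1 := by compute_degree
    have d3 : ((C a * X ^ p + C b) ^ (p - 1) : k[X]).natDegree ≤ (p - 1) * p :=
      Polynomial.natDegree_pow_le_of_le _ d1
    have d4 : ((C a' * X + C b') ^ (p - 2) : k[X]).natDegree ≤ (p - 2) * 1 :=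
      Polynomial.natDegree_pow_le_of_le _ d2
    have d5 : P.natDegree ≤ Fintype.card 𝔽 - 1 := by
      rw [hcard, ← e1]
      exact Polynomial.natDegree_mul_le_of_le Polynomial.natDegree_X_le
        (Polynomial.natDegree_mul_le_of_le d3 d4)
    have c1 : P.coeff (Fintype.card 𝔽 - 1) = a ^ (p - 1) * a' ^ (p - 2) := by
      rw [hcard, ← e1, hP, Polynomial.coeff_mul_add_eq_of_natDegree_le Polynomial.natDegree_X_le
        (Polynomial.natDegree_mul_le_of_le d3 d4), Polynomial.coeff_mul_add_eq_of_natDegree_le d3 d4,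
        Polynomial.coeff_pow_of_natDegree_le d1, Polynomial.coeff_pow_of_natDegree_le d2]
      simp [Polynomial.coeff_C, show p ≠ 0 by omega]
    have h2 := sum_eval_map φ d5
    rw [c1] at h2
    have hterm : ∀ x : 𝔽, φ x * ((a * φ x ^ p + b) ^ (p - 1) *
        ((a' * φ x + b') ^ (p - 2) * (c * φ x ^ p + d))) =
        (c / a) * (φ x * (a' * φ x + b') ^ (p - 1)) + ((a * d - b * c) / a) * P.eval (φ x) := by
      intro x
      have hfr : a' * φ x + b' = (a * φ x ^ p + b) ^ p := by
        rw [add_pow_char, mul_pow, ha, hb, hpow]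
      have e2 : c * φ x ^ p + d = (c / a) * (a * φ x ^ p + b) + (a * d - b * c) / a := by
        field_simp; ring
      have e3 : (a' * φ x + b') ^ (p - 1) = (a' * φ x + b') ^ (p - 2) * (a' * φ x + b') := by
        rw [← pow_succ]; congr 1; omega
      have e4 : (a * φ x ^ p + b) ^ p = (a * φ x ^ p + b) ^ (p - 1) * (a * φ x ^ p + b) := by
        rw [← pow_succ]; congr 1; omega
      have e5 : P.eval (φ x) =
          φ x * ((a * φ x ^ p + b) ^ (p - 1) * (a' * φ x + b') ^ (p - 2)) := by
        simp [hP]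
      rw [e5, e3]
      nth_rewrite 3 [hfr]
      rw [e4, e2]
      ring
    simp_rw [hterm]
    rw [Finset.sum_add_distrib, ← Finset.mul_sum, ← Finset.mul_sum, h1, h2, mul_pow]
    have e6 : a ^ (p - 1) = a ^ (p - 2) * a := by rw [← pow_succ]; congr 1; omega
    rw [e6]
    field_simp
    ring

end Sums

/-- A ring `O` with uniformizer `p` and residue field `𝔽` of order `p ^ 2`, together with the two
embeddings of `𝔽` in a field `k`, which are exchanged by Frobenius. -/
structure ResidueData (p : ℕ) (O 𝔽 k : Type*) [CommRing O] [Field 𝔽] [Fintype 𝔽] [Field k] where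
  /-- reduction -/
  red : O →+* 𝔽
  red_surjective : Function.Surjective red
  red_eq_zero : ∀ x, red x = 0 ↔ ∃ y, x = p * y
  isUnit_iff : ∀ x, IsUnit x ↔ red x ≠ 0
  mul_cancel : ∀ x y : O, (p : O) * x = p * y → x = y
  /-- the embeddings of the residue field -/
  emb : Bool → 𝔽 →+* k
  emb_pow : ∀ j x, emb j x ^ p = emb (!j) x
  card_eq : Fintype.card 𝔽 = p ^ 2

namespace ResidueData

variable {p : ℕ} {O 𝔽 k : Type*} [CommRing O] [Field 𝔽] [Fintype 𝔽] [Field k]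
  (D : ResidueData p O 𝔽 k)

/-- The composites of reduction with the two embeddings. -/
def ι (j : Bool) : O →+* k := (D.emb j).comp D.red

theorem ι_apply (j : Bool) (x : O) : D.ι j x = D.emb j (D.red x) := rfl

theorem ι_pow (j : Bool) (x : O) : D.ι j x ^ p = D.ι (!j) x := D.emb_pow j _

/-- A section of the reduction map. -/
noncomputable def lift (x : 𝔽) : O := Function.surjInv D.red_surjective x

@[simp] theorem red_lift (x : 𝔽) : D.red (D.lift x) = x := Function.surjInv_eq _ x

@[simp] theorem ι_lift (j : Bool) (x : 𝔽) : D.ι j (D.lift x) = D.emb j x := by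
  rw [ι_apply, red_lift]

theorem pow_pow (D : ResidueData p O 𝔽 k) (x : 𝔽) : (x ^ p) ^ p = x := by
  rw [← pow_mul, ← sq, ← D.card_eq, FiniteField.pow_card]

@[simp] theorem red_p : D.red (p : O) = 0 := (D.red_eq_zero _).2 ⟨1, (mul_one _).symm⟩

@[simp] theorem ι_p (j : Bool) : D.ι j (p : O) = 0 := by rw [ι_apply, red_p, map_zero]

/-- The Teichmüller-like representative used to index cosets. -/
noncomputable def rep (x : 𝔽) : O := D.lift x ^ p

@[simp] theorem red_rep (x : 𝔽) : D.red (D.rep x) = x ^ p := by rw [rep, map_pow, red_lift]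

@[simp] theorem ι_rep (j : Bool) (x : 𝔽) : D.ι j (D.rep x) = D.emb (!j) x := by
  rw [rep, map_pow, ι_lift, emb_pow]

theorem ι_not_pow (j : Bool) (x : O) : D.ι (!j) x ^ p = D.ι j x := by
  rw [D.ι_pow, Bool.not_not]

theorem ι_mul_pow (j : Bool) {x : O} (hp : 3 ≤ p) (hx : IsUnit x) :
    (D.ι j x * D.ι (!j) x) ^ (p - 2) * (D.ι j x * D.ι (!j) x) = 1 := by
  have h0 : D.red x ≠ 0 := (D.isUnit_iff x).1 hx
  have h1 := FiniteField.pow_card_sub_one_eq_one _ h0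
  rw [← pow_succ, ← D.ι_pow, ← pow_succ', ← pow_mul, ι_apply, ← map_pow]
  have : (p + 1) * (p - 2 + 1) = Fintype.card 𝔽 - 1 := by
    rw [D.card_eq]
    obtain ⟨r, rfl⟩ : ∃ r, p = r + 2 := ⟨p - 2, by omega⟩
    have h2 : r + 2 - 2 = r := by omega
    rw [h2]
    symm
    apply Nat.sub_eq_of_eq_add
    ring
  rw [this, h1, map_one]

/-- Division by `p`. -/
noncomputable def divp (p : ℕ) (x : O) : O := open Classical in
  if h : ∃ y, x = p * y then h.choose else 0

theorem divp_eq (D : ResidueData p O 𝔽 k) {x y : O} (h : x = p * y) : divp p x = y := by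
  have h' : ∃ y, x = p * y := ⟨y, h⟩
  rw [divp, dif_pos h']
  exact D.mul_cancel _ _ (h'.choose_spec.symm.trans h)

theorem charP_k (D : ResidueData p O 𝔽 k) [Fact p.Prime] : CharP k p := by
  refine (CharP.charP_iff_prime_eq_zero Fact.out).2 ?_
  rw [← map_natCast (D.ι true), ι_p]

end ResidueData

section Matrices

variable {R : Type*} [CommRing R]

/-- The upper unipotent matrix `[1, b; 0, 1]`. -/
def upperGL (b : R) : GL (Fin 2) R :=
  ⟨!![1, b; 0, 1], !![1, -b; 0, 1], by simp [Matrix.one_fin_two], by simp [Matrix.one_fin_two]⟩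

/-- The lower unipotent matrix `[1, 0; c, 1]`. -/
def lowerGL (c : R) : GL (Fin 2) R :=
  ⟨!![1, 0; c, 1], !![1, 0; -c, 1], by simp [Matrix.one_fin_two], by simp [Matrix.one_fin_two]⟩

/-- The matrix `[b, 1; 1, 0]`. -/
def swapGL (b : R) : GL (Fin 2) R :=
  ⟨!![b, 1; 1, 0], !![0, 1; 1, -b], by simp [Matrix.one_fin_two], by simp [Matrix.one_fin_two]⟩

@[simp] theorem coe_upperGL (b : R) : ((upperGL b : GL (Fin 2) R) : Matrix _ _ R) = !![1, b; 0, 1] := rfl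
@[simp] theorem coe_lowerGL (b : R) : ((lowerGL b : GL (Fin 2) R) : Matrix _ _ R) = !![1, 0; b, 1] := rfl
@[simp] theorem coe_swapGL (b : R) : ((swapGL b : GL (Fin 2) R) : Matrix _ _ R) = !![b, 1; 1, 0] := rfl
@[simp] theorem coe_swapGL_inv (b : R) :
    (((swapGL b)⁻¹ : GL (Fin 2) R) : Matrix _ _ R) = !![0, 1; 1, -b] := rfl

theorem GL2_mul_apply (g h : GL (Fin 2) R) (i j : Fin 2) :
    (g * h) i j = g i 0 * h 0 j + g i 1 * h 1 j := by
  simp [Matrix.mul_apply, Fin.sum_univ_two]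

theorem GL2_ext {g h : GL (Fin 2) R} (h00 : g 0 0 = h 0 0) (h01 : g 0 1 = h 0 1)
    (h10 : g 1 0 = h 1 0) (h11 : g 1 1 = h 1 1) : g = h := by
  apply Matrix.GeneralLinearGroup.ext
  intro i j
  fin_cases i <;> fin_cases j <;> assumption

/-- The determinant of a `2 × 2` matrix. -/
def det2 (g : GL (Fin 2) R) : R := g 0 0 * g 1 1 - g 0 1 * g 1 0

theorem isUnit_det2 (g : GL (Fin 2) R) : IsUnit (det2 g) := by
  have := (Matrix.isUnits_det_units g)
  rwa [Matrix.det_fin_two] at this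

theorem det2_mul (g h : GL (Fin 2) R) : det2 (g * h) = det2 g * det2 h := by
  simp only [det2, GL2_mul_apply]
  ring

end Matrices

/-- Data attached to an oriented edge. -/
@[ext]
structure EdgeVal (M : Type*) where
  /-- the principal component -/
  A : M
  /-- the components of weight one -/
  B : Bool → M
  /-- the components coupled to the weight one components of the next edge -/
  W : Bool → M

namespace ResidueData

variable {p : ℕ} {O 𝔽 k : Type*} [CommRing O] [Field 𝔽] [Fintype 𝔽] [Field k]
  (D : ResidueData p O 𝔽 k) {M : Type*} [AddCommGroup M] [Module k M]

/-- A bihomogeneous form in the first column `(a, c)`. -/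
def vform (a c : O) (A : M) (B : Bool → M) (C : M) : M :=
  (D.ι false a * D.ι true a) • A +
    ((D.ι true a * D.ι false c) • B false + (D.ι false a * D.ι true c) • B true) +
    (D.ι false c * D.ι true c) • C

theorem vform_eq (j : Bool) (a c : O) (A : M) (B : Bool → M) (C : M) :
    D.vform a c A B C = (D.ι j a * D.ι (!j) a) • A +
    ((D.ι (!j) a * D.ι j c) • B j + (D.ι j a * D.ι (!j) c) • B (!j)) +
    (D.ι j c * D.ι (!j) c) • C := by
  cases j
  · rfl
  · simp only [vform, Bool.not_true]
    module

/-- The action of an upper triangular matrix (modulo `p`) on edge data. -/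
def act (a b d : O) (e : EdgeVal M) : EdgeVal M where
  A := (D.ι false a * D.ι true a) • e.A
  B := fun j => D.ι (!j) a • (D.ι j d • e.B j + D.ι j b • e.A)
  W := fun j => (D.ι j d * D.ι (!j) a) • e.W j

/-- The conditions imposed on the restriction to a vertex. -/
structure VertexCond (ψ : Bool → M →ₗ[k] M) (F : GL (Fin 2) O → M × EdgeVal M) : Prop where
  form : ∃ A B C, ∀ κ, (F κ).1 = D.vform (κ 0 0) (κ 1 0) A B C
  mul : ∀ (κ i : GL (Fin 2) O) (c : O), i 1 0 = p * c → (F (κ * i)).2 = D.act (i 1 1) c (i 0 0) (F κ).2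
  sum_A : ∀ κ j m, m < p → ∑ x, D.emb j x ^ m • (F (κ * swapGL (D.rep x))).2.A = 0
  sum_W : ∀ κ j, ∑ x, D.emb j x • (F (κ * swapGL (D.rep x))).2.W j = ψ j (F κ).2.A

/-- The data on the edge fixed by the upper triangular matrices modulo `p`. -/
noncomputable def topEdge (F : GL (Fin 2) O → M × EdgeVal M) : EdgeVal M where
  A := (F 1).1
  B := fun j => -∑ x, D.emb j x ^ (p ^ 2 - 2) • (F (lowerGL (D.lift x))).1
  W := fun j => ∑ x, (F (swapGL (D.rep x))).2.B j

/-- The value at the base edge. -/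
def botEdge (F : GL (Fin 2) O → M × EdgeVal M) : EdgeVal M := (F 1).2

theorem vform_left_mul (κ₀ κ : GL (Fin 2) O) (A : M) (B : Bool → M) (C : M) :
    D.vform ((κ₀ * κ) 0 0) ((κ₀ * κ) 1 0) A B C =
    D.vform (κ 0 0) (κ 1 0) (D.vform (κ₀ 0 0) (κ₀ 1 0) A B C)
      (fun j => (D.ι (!j) (κ₀ 0 0) * D.ι j (κ₀ 0 1)) • A + (D.ι (!j) (κ₀ 0 0) * D.ι j (κ₀ 1 1)) • B j
        + (D.ι j (κ₀ 0 1) * D.ι (!j) (κ₀ 1 0)) • B (!j)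
        + (D.ι j (κ₀ 1 1) * D.ι (!j) (κ₀ 1 0)) • C)
      (D.vform (κ₀ 0 1) (κ₀ 1 1) A B C) := by
  simp only [vform, GL2_mul_apply, map_add, map_mul, Bool.not_false, Bool.not_true]
  module

variable {D} {ψ : Bool → M →ₗ[k] M} {F : GL (Fin 2) O → M × EdgeVal M}

theorem VertexCond.left_mul (h : D.VertexCond ψ F) (κ₀ : GL (Fin 2) O) :
    D.VertexCond ψ (fun κ => F (κ₀ * κ)) where
  form := by
    obtain ⟨A, B, C, hF⟩ := h.form
    exact ⟨_, _, _, fun κ => by rw [hF, vform_left_mul]⟩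
  mul κ i c hi := by rw [← mul_assoc, h.mul _ _ _ hi]
  sum_A κ j m hm := by simp_rw [← mul_assoc]; exact h.sum_A _ j m hm
  sum_W κ j := by simp_rw [← mul_assoc]; exact h.sum_W _ j

theorem topEdge_A_of_form {A B C} (hF : ∀ κ, (F κ).1 = D.vform (κ 0 0) (κ 1 0) A B C) :
    (D.topEdge F).A = A := by
  simp [topEdge, hF, vform]

theorem topEdge_B_of_form (hp : 3 ≤ p) {A B C}
    (hF : ∀ κ, (F κ).1 = D.vform (κ 0 0) (κ 1 0) A B C) :
    (D.topEdge F).B = B := by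
  funext j
  have hq := D.card_eq
  have h9 : 3 * p ≤ p ^ 2 := by nlinarith
  have hfrob : ∀ x, D.emb j x ^ (p ^ 2) = D.emb j x := fun x => by
    rw [← map_pow, ← hq, FiniteField.pow_card]
  have e0 : ∑ x, D.emb j x ^ (p ^ 2 - 2) = 0 := sum_pow_map_eq_zero _ (by omega)
  have e1 : ∑ x, D.emb j x ^ (p ^ 2 - 2) * D.emb j x = -1 := by
    simp_rw [← pow_succ]
    rw [show p ^ 2 - 2 + 1 = Fintype.card 𝔽 - 1 by omega]
    exact sum_pow_map_eq_neg_one _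
  have e2 : ∑ x, D.emb j x ^ (p ^ 2 - 2) * D.emb (!j) x = 0 := by
    rw [← sum_pow_map_eq_zero (D.emb j) (m := p - 1) (by omega)]
    refine Finset.sum_congr rfl fun x _ => ?_
    rw [← D.emb_pow, ← pow_add, show p ^ 2 - 2 + p = p ^ 2 + (p - 2) by omega, pow_add, hfrob,
      ← pow_succ']
    congr 1; omega
  have e3 : ∑ x, D.emb j x ^ (p ^ 2 - 2) * (D.emb j x * D.emb (!j) x) = 0 := by
    rw [← sum_pow_map_eq_zero (D.emb j) (m := p) (by omega)]
    refine Finset.sum_congr rfl fun x _ => ?_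
    rw [← D.emb_pow, ← pow_succ', ← pow_add, show p ^ 2 - 2 + (p + 1) = p ^ 2 + (p - 1) by omega,
      pow_add, hfrob, ← pow_succ']
    congr 1; omega
  have key : ∀ x, D.emb j x ^ (p ^ 2 - 2) • (F (lowerGL (D.lift x))).1 =
      (D.emb j x ^ (p ^ 2 - 2)) • A + ((D.emb j x ^ (p ^ 2 - 2) * D.emb j x) • B j +
        (D.emb j x ^ (p ^ 2 - 2) * D.emb (!j) x) • B (!j)) +
        (D.emb j x ^ (p ^ 2 - 2) * (D.emb j x * D.emb (!j) x)) • C := by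
    intro x
    rw [hF, D.vform_eq j]
    simp [smul_add, smul_smul]
  simp only [topEdge, key, Finset.sum_add_distrib, ← Finset.sum_smul, e0, e1, e2, e3]
  simp

theorem isUnit_diag {i : GL (Fin 2) O} {c : O} (hi : i 1 0 = p * c) (D : ResidueData p O 𝔽 k) :
    D.red (i 0 0) ≠ 0 ∧ D.red (i 1 1) ≠ 0 := by
  have h := (D.isUnit_iff _).1 (isUnit_det2 i)
  rw [det2, hi, map_sub, map_mul, map_mul, map_mul, red_p, zero_mul, mul_zero, sub_zero] at h
  exact mul_ne_zero_iff.1 h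

theorem VertexCond.sum_A_eval (h : D.VertexCond ψ F) (κ : GL (Fin 2) O) (j : Bool)
    {P : Polynomial k} (hP : P.natDegree < p) :
    ∑ x, P.eval (D.emb j x) • (F (κ * swapGL (D.rep x))).2.A = 0 := by
  simp_rw [Polynomial.eval_eq_sum_range' hP, Finset.sum_smul]
  rw [Finset.sum_comm]
  refine Finset.sum_eq_zero fun m hm => ?_
  simp_rw [mul_smul]
  rw [← Finset.smul_sum, h.sum_A κ j m (Finset.mem_range.1 hm), smul_zero]

theorem exists_pow_eq_of_red_eq (hp : 3 ≤ p) [Fact p.Prime] (D : ResidueData p O 𝔽 k) {u v : O}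
    (h : D.red u = D.red v) : ∃ t, u ^ p = v ^ p + p * (p * t) := by
  obtain ⟨s, hs⟩ := (D.red_eq_zero (u - v)).1 (by rw [map_sub, h, sub_self])
  have hu : u = v + p * s := by rw [← hs]; ring
  rw [hu, add_pow_prime_eq Fact.out]
  have hpp : (p : O) ^ p = p * (p * p ^ (p - 2)) := by
    rw [← pow_succ', ← pow_succ']; congr 1; omega
  rw [mul_pow, hpp]
  exact ⟨_, by
    rw [show ∀ S : O, v ^ p + p * (p * (p : O) ^ (p - 2)) * s ^ p + p * v * (p * s) * S =
      v ^ p + p * (p * ((p : O) ^ (p - 2) * s ^ p + v * s * S)) from fun S => by ring]⟩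

open Polynomial in
/-- The lower left entry of `(swapGL (rep (α x + β)))⁻¹ * i * swapGL (rep x)`, divided by `p`,
is modulo `p` a polynomial of low degree. -/
theorem exists_eval_eq (hp : 3 ≤ p) [Fact p.Prime] (D : ResidueData p O 𝔽 k) (j : Bool)
    (a b c d : O) (hd : D.red d ≠ 0) (α β : 𝔽) (hα : α = (D.red a / D.red d) ^ p)
    (hβ : β = (D.red b / D.red d) ^ p) :
    ∃ P₁ P₂ : k[X], P₁.natDegree < p ∧ P₂.natDegree < p ∧ ∀ x, ∃ γ,
      a * D.rep x + b - D.rep (α * x + β) * (p * c * D.rep x + d) = p * γ ∧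
      D.ι j γ = P₁.eval (D.emb j x) + P₂.eval (D.emb (!j) x) := by
  obtain ⟨a₁, ha₁⟩ := (D.red_eq_zero (a - d * D.lift α ^ p)).1 (by
    rw [map_sub, map_mul, map_pow, red_lift, hα, D.pow_pow]; field_simp; ring)
  obtain ⟨b₁, hb₁⟩ := (D.red_eq_zero (b - d * D.lift β ^ p)).1 (by
    rw [map_sub, map_mul, map_pow, red_lift, hβ, D.pow_pow]; field_simp; ring)
  refine ⟨C (D.ι j b₁) - C (D.ι j d * D.emb j α * D.emb j β) * (X *
    ∑ m ∈ Finset.Ioo 0 p, (C (D.emb j α) * X) ^ (m - 1) *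
      C (D.emb j β ^ (p - m - 1) * ((p.choose m / p : ℕ) : k))),
    C (D.ι j a₁) * X - C (D.ι j c) * (X * (C (D.emb (!j) α) * X + C (D.emb (!j) β))), ?_, ?_, ?_⟩
  · refine lt_of_le_of_lt (b := p - 1) ?_ (by omega)
    refine (natDegree_sub_le _ _).trans (max_le (by simp) ?_)
    refine (natDegree_C_mul_le _ _).trans ?_
    have hs : (∑ m ∈ Finset.Ioo 0 p, (C (D.emb j α) * X) ^ (m - 1) *
      C (D.emb j β ^ (p - m - 1) * ((p.choose m / p : ℕ) : k)) : k[X]).natDegree ≤ p - 2 := by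
      refine natDegree_sum_le_of_forall_le _ _ fun m hm => ?_
      rw [Finset.mem_Ioo] at hm
      refine (natDegree_mul_C_le _ _).trans ?_
      refine (natDegree_pow_le_of_le _ (m := 1) (by compute_degree)).trans ?_
      omega
    refine (natDegree_mul_le_of_le natDegree_X_le hs).trans ?_
    omega
  · refine lt_of_le_of_lt (b := 2) ?_ (by omega)
    compute_degree
  · intro x
    obtain ⟨t, ht⟩ := exists_pow_eq_of_red_eq hp D
      (u := D.lift (α * x + β)) (v := D.lift α * D.lift x + D.lift β) (by simp)
    set S : O := ∑ m ∈ Finset.Ioo 0 p, (D.lift α * D.lift x) ^ (m - 1) *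
      D.lift β ^ (p - m - 1) * ((p.choose m / p : ℕ) : O) with hS
    refine ⟨a₁ * D.rep x + b₁ - d * (D.lift α * D.lift x) * D.lift β * S - d * (p * t)
      - c * D.rep x * D.rep (α * x + β), ?_, ?_⟩
    · have h1 : D.rep (α * x + β) = D.lift α ^ p * D.rep x + D.lift β ^ p
          + p * (D.lift α * D.lift x) * D.lift β * S + p * (p * t) := by
        simp only [rep]
        rw [ht, add_pow_prime_eq Fact.out, mul_pow]
      have h2 : a * D.rep x + b = (p * a₁ + d * D.lift α ^ p) * D.rep x +
          (p * b₁ + d * D.lift β ^ p) := by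
        rw [← ha₁, ← hb₁]; ring
      rw [h2, h1]
      ring
    · have h3 : D.ι j S = ∑ m ∈ Finset.Ioo 0 p, (D.emb j α * D.emb j x) ^ (m - 1) *
          (D.emb j β ^ (p - m - 1) * ((p.choose m / p : ℕ) : k)) := by
        rw [hS, map_sum]
        refine Finset.sum_congr rfl fun m _ => ?_
        simp only [map_mul, map_pow, ι_lift, map_natCast, mul_assoc]
      simp only [map_sub, map_add, map_mul, h3, ι_lift, ι_rep, ι_p, eval_sub, eval_C, eval_mul,
        eval_X, eval_finsetSum, eval_add, eval_pow]
      ring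

theorem VertexCond.botEdge_mul (h : D.VertexCond ψ F) {i : GL (Fin 2) O} {c : O}
    (hi : i 1 0 = p * c) :
    botEdge (fun κ => F (i * κ)) = D.act (i 1 1) c (i 0 0) (botEdge F) := by
  have := h.mul 1 i c hi
  rw [one_mul] at this
  simpa [botEdge] using this

theorem VertexCond.topEdge_W_mul (hp : 3 ≤ p) [Fact p.Prime] (h : D.VertexCond ψ F)
    {i : GL (Fin 2) O} {c : O} (hi : i 1 0 = p * c) (j : Bool) :
    ∑ x, (F (i * swapGL (D.rep x))).2.B j =
      (D.ι j (i 1 1) * D.ι (!j) (i 0 0)) • ∑ x, (F (swapGL (D.rep x))).2.B j := by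
  obtain ⟨ha, hd⟩ := isUnit_diag hi D
  set α := (D.red (i 0 0) / D.red (i 1 1)) ^ p with hα
  set β := (D.red (i 0 1) / D.red (i 1 1)) ^ p with hβ
  have hα0 : α ≠ 0 := pow_ne_zero _ (div_ne_zero ha hd)
  let σ : 𝔽 ≃ 𝔽 :=
    { toFun := fun x => α * x + β
      invFun := fun x => α⁻¹ * (x - β)
      left_inv := fun x => by field_simp; ring
      right_inv := fun x => by field_simp; ring }
  obtain ⟨P₁, P₂, hP₁, hP₂, hP⟩ := exists_eval_eq hp D j (i 0 0) (i 0 1) c (i 1 1) hd α β hα hβ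
  have hterm : ∀ x, (F (i * swapGL (D.rep x))).2.B j =
      (D.ι j (i 1 1) * D.ι (!j) (i 0 0)) • (F (swapGL (D.rep (σ x)))).2.B j +
      (D.ι (!j) (i 0 0)) • ((P₁.eval (D.emb j x) + P₂.eval (D.emb (!j) x)) •
        (F (swapGL (D.rep (σ x)))).2.A) := by
    intro x
    obtain ⟨γ, hγ, hγ'⟩ := hP x
    set i' := (swapGL (D.rep (σ x)))⁻¹ * (i * swapGL (D.rep x)) with hi'
    have e10 : i' 1 0 = p * γ := by
      rw [← hγ]
      simp only [hi', GL2_mul_apply, coe_swapGL_inv, coe_swapGL, hi]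
      simp [σ]
      ring
    have e00 : i' 0 0 = p * c * D.rep x + i 1 1 := by
      simp only [hi', GL2_mul_apply, coe_swapGL_inv, coe_swapGL, hi]
      simp
    have e11 : i' 1 1 = i 0 0 - D.rep (σ x) * (p * c) := by
      simp only [hi', GL2_mul_apply, coe_swapGL_inv, coe_swapGL, hi]
      simp [σ]
      ring
    have e : i * swapGL (D.rep x) = swapGL (D.rep (σ x)) * i' := by
      rw [hi', mul_inv_cancel_left]
    rw [e, h.mul _ _ _ e10, e00, e11]
    simp only [act, map_sub, map_add, map_mul, ι_p, hγ', zero_mul, mul_zero, zero_add, sub_zero]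
    module
  have hz : ∀ (j' : Bool) (P : Polynomial k), P.natDegree < p →
      ∑ x, P.eval (D.emb j' x) • (F (swapGL (D.rep (σ x)))).2.A = 0 := by
    intro j' P hdeg
    have h1 := h.sum_A_eval 1 j' (P := P.comp (Polynomial.C (D.emb j' α⁻¹) *
      (Polynomial.X - Polynomial.C (D.emb j' β)))) (by
        refine lt_of_le_of_lt ?_ hdeg
        refine Polynomial.natDegree_comp_le.trans ?_
        have h2 : (Polynomial.C (D.emb j' α⁻¹) *
          (Polynomial.X - Polynomial.C (D.emb j' β))).natDegree ≤ 1 := by compute_degree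
        simpa using Nat.mul_le_mul_left P.natDegree h2)
    rw [← h1, ← Equiv.sum_comp σ (fun x => Polynomial.eval (D.emb j' x)
      (P.comp (Polynomial.C (D.emb j' α⁻¹) * (Polynomial.X - Polynomial.C (D.emb j' β)))) •
        (F (1 * swapGL (D.rep x))).2.A)]
    refine Finset.sum_congr rfl fun x _ => ?_
    rw [one_mul]
    congr 1
    rw [Polynomial.eval_comp]
    congr 1
    have h3 : x = α⁻¹ * (σ x - β) := (σ.symm_apply_apply x).symm
    conv_lhs => rw [h3]
    simp
  simp_rw [hterm, add_smul, smul_add]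
  rw [Finset.sum_add_distrib, Finset.sum_add_distrib, ← Finset.smul_sum, ← Finset.smul_sum,
    ← Finset.smul_sum, hz j P₁ hP₁, hz (!j) P₂ hP₂, smul_zero, add_zero, add_zero,
    Equiv.sum_comp σ (fun x => (F (swapGL (D.rep x))).2.B j)]

theorem VertexCond.topEdge_mul (hp : 3 ≤ p) [Fact p.Prime] (h : D.VertexCond ψ F)
    {i : GL (Fin 2) O} {c : O} (hi : i 1 0 = p * c) :
    D.topEdge (fun κ => F (i * κ)) = D.act (i 0 0) (i 0 1) (i 1 1) (D.topEdge F) := by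
  obtain ⟨A, B, C, hF⟩ := h.form
  have hF' : ∀ κ, (F (i * κ)).1 = _ := fun κ => by rw [hF, vform_left_mul]
  ext1
  · rw [topEdge_A_of_form hF', act, topEdge_A_of_form hF]
    simp only [vform, hi, map_mul, ι_p, zero_mul, mul_zero, zero_smul, add_zero]
  · rw [topEdge_B_of_form hp hF', act, topEdge_A_of_form hF, topEdge_B_of_form hp hF]
    funext j
    simp only [hi, map_mul, ι_p, zero_mul, mul_zero, zero_smul, add_zero]
    module
  · funext j
    exact h.topEdge_W_mul hp hi j

end ResidueData

namespace ResidueData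

variable {p : ℕ} {O 𝔽 k : Type*} [CommRing O] [Field 𝔽] [Fintype 𝔽] [Field k]
  (D : ResidueData p O 𝔽 k) {M : Type*} [AddCommGroup M] [Module k M]

/-- The principal component of the extension to a vertex. -/
def extA (η : M) (κ : GL (Fin 2) O) : M :=
  ((D.ι false (det2 κ) * D.ι true (det2 κ)) * (D.ι false (κ 0 0) * D.ι true (κ 0 0)) ^ (p - 2)) • η

/-- The coupling components of the extension to a vertex. -/
def extW (ψ : Bool → M →ₗ[k] M) (e : EdgeVal M) (κ : GL (Fin 2) O) (j : Bool) : M :=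
  D.ι (!j) (det2 κ) • (D.ι (!j) (κ 0 0) ^ (p - 1) • e.W j +
    (D.ι j (κ 0 0) ^ (p - 1) * (D.ι (!j) (κ 0 0) ^ (p - 2) * D.ι j (κ 1 0))) • ψ j e.A)

open Classical in
/-- A representative of the coset of `κ` modulo the Iwahori subgroup. -/
noncomputable def cosetRep (κ : GL (Fin 2) O) : GL (Fin 2) O :=
  if D.red (κ 1 0) = 0 then 1 else swapGL (D.rep ((D.red (κ 0 0) / D.red (κ 1 0)) ^ p))

open Classical in
/-- The values of the weight one components at the coset representatives. -/
noncomputable def cosetVal (e e' : EdgeVal M) (κ : GL (Fin 2) O) (j : Bool) : M :=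
  if D.red (κ 1 0) = 0 then e'.B j else if D.red (κ 0 0) = 0 then e.W j else 0

/-- The weight one components of the extension to a vertex. -/
noncomputable def extB (e e' : EdgeVal M) (κ : GL (Fin 2) O) (j : Bool) : M :=
  D.ι (!j) (((D.cosetRep κ)⁻¹ * κ) 1 1) •
    (D.ι j (((D.cosetRep κ)⁻¹ * κ) 0 0) • D.cosetVal e e' κ j +
      D.ι j (divp p (((D.cosetRep κ)⁻¹ * κ) 1 0)) • D.extA e'.A (D.cosetRep κ))

/-- A function on `GL (Fin 2) O` with prescribed values at two edges. -/
noncomputable def ext (ψ : Bool → M →ₗ[k] M) (e e' : EdgeVal M) (κ : GL (Fin 2) O) :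
    M × EdgeVal M :=
  (D.vform (κ 0 0) (κ 1 0) e.A e.B 0, ⟨D.extA e'.A κ, D.extB e e' κ, D.extW ψ e' κ⟩)

variable {D}

theorem extA_eq (j : Bool) (η : M) (κ : GL (Fin 2) O) : D.extA η κ =
    ((D.ι j (det2 κ) * D.ι (!j) (det2 κ)) * (D.ι j (κ 0 0) * D.ι (!j) (κ 0 0)) ^ (p - 2)) • η := by
  cases j
  · rfl
  · rw [extA, Bool.not_true, mul_comm (D.ι true _), mul_comm (D.ι true (κ 0 0))]

theorem ι_mul_entry {i : GL (Fin 2) O} {c : O} (hi : i 1 0 = p * c) (κ : GL (Fin 2) O) (j : Bool) :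
    D.ι j ((κ * i) 0 0) = D.ι j (κ 0 0) * D.ι j (i 0 0) ∧
    D.ι j ((κ * i) 1 0) = D.ι j (κ 1 0) * D.ι j (i 0 0) ∧
    D.ι j (det2 (κ * i)) = D.ι j (det2 κ) * (D.ι j (i 0 0) * D.ι j (i 1 1)) := by
  refine ⟨?_, ?_, ?_⟩
  · simp only [GL2_mul_apply, hi, map_add, map_mul, ι_p, zero_mul, mul_zero, add_zero]
  · simp only [GL2_mul_apply, hi, map_add, map_mul, ι_p, zero_mul, mul_zero, add_zero]
  · rw [det2_mul]
    simp only [det2, hi, map_sub, map_mul, ι_p, zero_mul, mul_zero, sub_zero]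

theorem isUnit_diag' {i : GL (Fin 2) O} {c : O} (hi : i 1 0 = p * c) (D : ResidueData p O 𝔽 k) :
    IsUnit (i 0 0) ∧ IsUnit (i 1 1) :=
  (isUnit_diag hi D).imp (D.isUnit_iff _).2 (D.isUnit_iff _).2

theorem extA_mul (hp : 3 ≤ p) (η : M) (κ : GL (Fin 2) O) {i : GL (Fin 2) O} {c : O}
    (hi : i 1 0 = p * c) :
    D.extA η (κ * i) = (D.ι false (i 1 1) * D.ι true (i 1 1)) • D.extA η κ := by
  have h := D.ι_mul_pow false hp (isUnit_diag' hi D).1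
  simp only [Bool.not_false] at h
  obtain ⟨e1, -, e2⟩ := ι_mul_entry (D := D) hi κ false
  obtain ⟨e3, -, e4⟩ := ι_mul_entry (D := D) hi κ true
  rw [extA, extA, e1, e2, e3, e4, smul_smul]
  congr 1
  rw [mul_mul_mul_comm (D.ι false (κ 0 0)), mul_pow]
  linear_combination (D.ι false (det2 κ) * D.ι true (det2 κ) * D.ι false (i 1 1) *
    D.ι true (i 1 1) * (D.ι false (κ 0 0) * D.ι true (κ 0 0)) ^ (p - 2)) * h

theorem extW_mul (hp : 3 ≤ p) (ψ : Bool → M →ₗ[k] M) (e : EdgeVal M) (κ : GL (Fin 2) O)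
    {i : GL (Fin 2) O} {c : O} (hi : i 1 0 = p * c) (j : Bool) :
    D.extW ψ e (κ * i) j = (D.ι j (i 0 0) * D.ι (!j) (i 1 1)) • D.extW ψ e κ j := by
  obtain ⟨e1, e2, e3⟩ := ι_mul_entry (D := D) hi κ j
  obtain ⟨e4, e5, e6⟩ := ι_mul_entry (D := D) hi κ (!j)
  have h1 := D.ι_pow j (i 0 0)
  have h2 := D.ι_not_pow j (i 0 0)
  obtain ⟨r, rfl⟩ : ∃ r, p = r + 2 := ⟨p - 2, by omega⟩
  rw [extW, extW, e1, e2, e4, e6]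
  simp only [smul_add, smul_smul]
  have hr1 : r + 2 - 1 = r + 1 := by omega
  have hr2 : r + 2 - 2 = r := by omega
  rw [hr1, hr2]
  congr 2
  · rw [← h2]; ring
  · rw [mul_pow, mul_pow]
    generalize D.ι j (i 0 0) = u at *
    generalize D.ι (!j) (i 0 0) = v at *
    generalize D.ι j (κ 0 0) = a at *
    generalize D.ι (!j) (κ 0 0) = b at *
    have h3 : u ^ (r + 2) * v ^ (r + 1) = u := by
      rw [h1, ← h2]; ring
    linear_combination (D.ι (!j) (det2 κ) * D.ι (!j) (i 1 1) * a ^ (r + 1) * b ^ r * D.ι j (κ 1 0))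
      * h3

theorem red_mul_entry {i : GL (Fin 2) O} {c : O} (hi : i 1 0 = p * c) (κ : GL (Fin 2) O)
    (n : Fin 2) : D.red ((κ * i) n 0) = D.red (κ n 0) * D.red (i 0 0) := by
  simp only [GL2_mul_apply, hi, map_add, map_mul, red_p, zero_mul, mul_zero, add_zero]

theorem red_mul_entry_eq_zero {i : GL (Fin 2) O} {c : O} (hi : i 1 0 = p * c) (κ : GL (Fin 2) O)
    (n : Fin 2) : D.red ((κ * i) n 0) = 0 ↔ D.red (κ n 0) = 0 := by
  rw [red_mul_entry hi, mul_eq_zero, or_iff_left (isUnit_diag hi D).1]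

theorem cosetRep_mul (κ : GL (Fin 2) O) {i : GL (Fin 2) O} {c : O} (hi : i 1 0 = p * c) :
    D.cosetRep (κ * i) = D.cosetRep κ := by
  classical
  refine if_congr (red_mul_entry_eq_zero hi κ 1) rfl ?_
  rw [red_mul_entry hi, red_mul_entry hi, mul_div_mul_right _ _ (isUnit_diag hi D).1]

theorem cosetVal_mul (e e' : EdgeVal M) (κ : GL (Fin 2) O) {i : GL (Fin 2) O} {c : O}
    (hi : i 1 0 = p * c) : D.cosetVal e e' (κ * i) = D.cosetVal e e' κ := by
  classical
  funext j
  exact if_congr (red_mul_entry_eq_zero hi κ 1) rfl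
    (if_congr (red_mul_entry_eq_zero hi κ 0) rfl rfl)

theorem exists_cosetRep (D : ResidueData p O 𝔽 k) (κ : GL (Fin 2) O) :
    ∃ c, ((D.cosetRep κ)⁻¹ * κ) 1 0 = p * c := by
  by_cases h : D.red (κ 1 0) = 0
  · rw [cosetRep, if_pos h, inv_one, one_mul]
    exact (D.red_eq_zero _).1 h
  · rw [cosetRep, if_neg h]
    refine (D.red_eq_zero _).1 ?_
    simp only [GL2_mul_apply, coe_swapGL_inv]
    simp [D.pow_pow]
    field_simp
    ring

theorem extB_mul (hp : 3 ≤ p) (e e' : EdgeVal M) (κ : GL (Fin 2) O)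
    {i : GL (Fin 2) O} {c : O} (hi : i 1 0 = p * c) (j : Bool) :
    D.extB e e' (κ * i) j = D.ι (!j) (i 1 1) • (D.ι j (i 0 0) • D.extB e e' κ j +
      D.ι j c • D.extA e'.A κ) := by
  rw [extB, extB, cosetRep_mul κ hi, cosetVal_mul e e' κ hi, ← mul_assoc]
  obtain ⟨γ, hγ⟩ := D.exists_cosetRep κ
  set i' := (D.cosetRep κ)⁻¹ * κ with hi'
  have hκ : κ = D.cosetRep κ * i' := by rw [hi', mul_inv_cancel_left]
  have h1 : D.extA e'.A κ = (D.ι j (i' 1 1) * D.ι (!j) (i' 1 1)) • D.extA e'.A (D.cosetRep κ) := by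
    conv_lhs => rw [hκ, extA_mul hp _ _ hγ]
    cases j
    · rfl
    · rw [mul_comm]; rfl
  have h2 : (i' * i) 1 0 = p * (γ * i 0 0 + i' 1 1 * c) := by
    rw [GL2_mul_apply, hγ, hi]; ring
  have h3 : D.ι (!j) ((i' * i) 1 1) = D.ι (!j) (i' 1 1) * D.ι (!j) (i 1 1) := by
    rw [GL2_mul_apply, hγ, map_add, map_mul, map_mul, map_mul, ι_p]; ring
  rw [D.divp_eq h2, D.divp_eq hγ, h3, (ι_mul_entry hi i' j).1, h1]
  simp only [map_add, map_mul]
  module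

theorem det2_swapGL (b : O) : det2 (swapGL b) = -1 := by simp [det2]

theorem cosetRep_swapGL (x : 𝔽) : D.cosetRep (swapGL (D.rep x)) = swapGL (D.rep x) := by
  simp [cosetRep, D.pow_pow]

theorem extB_swapGL (hp : 3 ≤ p) (e e' : EdgeVal M) (x : 𝔽) (j : Bool) [DecidableEq 𝔽] :
    D.extB e e' (swapGL (D.rep x)) j = if x = 0 then e.W j else 0 := by
  have hdiv : divp p (0 : O) = 0 := D.divp_eq (by simp)
  rw [extB, cosetRep_swapGL, inv_mul_cancel]
  have : p ≠ 0 := by omega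
  simp [hdiv, cosetVal, this]

theorem extB_one (e e' : EdgeVal M) (j : Bool) : D.extB e e' 1 j = e'.B j := by
  have hdiv : divp p (0 : O) = 0 := D.divp_eq (by simp)
  simp [extB, cosetRep, cosetVal, hdiv]

theorem vertexCond_ext (hp : 3 ≤ p) [Fact p.Prime] (ψ : Bool → M →ₗ[k] M) (e e' : EdgeVal M) :
    D.VertexCond ψ (D.ext ψ e e') where
  form := ⟨_, _, _, fun κ => rfl⟩
  mul κ i c hi := by
    ext1
    · exact extA_mul hp _ _ hi
    · funext j; exact extB_mul hp e e' κ hi j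
    · funext j; exact extW_mul hp ψ e' κ hi j
  sum_A κ j m hm := by
    have h := sum_pow_mul_linear_eq_zero (D.emb j) hp D.card_eq hm (D.ι j (κ 0 0))
      (D.ι j (κ 0 1)) (D.ι (!j) (κ 0 0)) (D.ι (!j) (κ 0 1))
    simp only [ext, extA_eq j, det2_mul, det2_swapGL, smul_smul, ← Finset.sum_smul]
    convert zero_smul k e'.A
    rw [← mul_zero (D.ι j (det2 κ) * D.ι (!j) (det2 κ)), ← h, Finset.mul_sum]
    refine Finset.sum_congr rfl fun x _ => ?_
    simp [GL2_mul_apply, D.emb_pow]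
    ring
  sum_W κ j := by
    have := D.charP_k
    have h1 := sum_mul_linear_pow_eq_zero (D.emb j) hp D.card_eq (D.ι (!j) (κ 0 0))
      (D.ι (!j) (κ 0 1))
    have h2 := sum_mul_pow_mul_pow_mul (D.emb j) hp D.card_eq (c := D.ι j (κ 1 0))
      (d := D.ι j (κ 1 1)) (D.ι_pow j (κ 0 0)) (D.ι_pow j (κ 0 1))
    have hterm : ∀ x, D.emb j x • D.extW ψ e' (κ * swapGL (D.rep x)) j =
        (-D.ι (!j) (det2 κ) * (D.emb j x *
          (D.ι (!j) (κ 0 0) * D.emb j x + D.ι (!j) (κ 0 1)) ^ (p - 1))) • e'.W j +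
        (-D.ι (!j) (det2 κ) * (D.emb j x * ((D.ι j (κ 0 0) * D.emb j x ^ p + D.ι j (κ 0 1)) ^ (p - 1)
          * ((D.ι (!j) (κ 0 0) * D.emb j x + D.ι (!j) (κ 0 1)) ^ (p - 2) *
            (D.ι j (κ 1 0) * D.emb j x ^ p + D.ι j (κ 1 1)))))) • ψ j e'.A := by
      intro x
      simp only [extW, det2_mul, det2_swapGL, D.emb_pow, GL2_mul_apply, map_add, map_mul,
        coe_swapGL, map_neg, map_one]
      simp [smul_smul]
      module
    simp only [ext, hterm, Finset.sum_add_distrib, ← Finset.sum_smul, ← Finset.mul_sum, h1, h2]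
    rw [extA_eq j, map_smul, mul_zero, zero_smul, zero_add]
    congr 1
    simp only [det2, map_sub, map_mul]
    ring

theorem topEdge_ext (hp : 3 ≤ p) (ψ : Bool → M →ₗ[k] M) (e e' : EdgeVal M) :
    D.topEdge (D.ext ψ e e') = e := by
  classical
  ext1
  · exact topEdge_A_of_form fun _ => rfl
  · exact topEdge_B_of_form hp fun _ => rfl
  · funext j
    simp [topEdge, ext, extB_swapGL hp]

theorem botEdge_ext (ψ : Bool → M →ₗ[k] M) (e e' : EdgeVal M) :
    botEdge (D.ext ψ e e') = e' := by
  ext1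
  · simp [botEdge, ext, extA, det2]
  · funext j; exact extB_one e e' j
  · funext j
    simp [botEdge, ext, extW, det2]

variable (D) in
/-- The function supported in the lowest coefficient. -/
def rootFun (C : M) (κ : GL (Fin 2) O) : M × EdgeVal M :=
  (D.vform (κ 0 0) (κ 1 0) 0 0 C, ⟨0, 0, 0⟩)

theorem vertexCond_rootFun (ψ : Bool → M →ₗ[k] M) (C : M) : D.VertexCond ψ (D.rootFun C) where
  form := ⟨_, _, _, fun κ => rfl⟩
  mul κ i c hi := by
    ext1
    · simp [rootFun, act]
    · funext j; simp [rootFun, act]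
    · funext j; simp [rootFun, act]
  sum_A κ j m hm := by simp [rootFun]
  sum_W κ j := by simp [rootFun]

theorem topEdge_rootFun (hp : 3 ≤ p) (C : M) : D.topEdge (D.rootFun C) = ⟨0, 0, 0⟩ := by
  ext1
  · exact topEdge_A_of_form fun _ => rfl
  · exact topEdge_B_of_form hp fun _ => rfl
  · funext j
    simp [topEdge, rootFun]

theorem botEdge_rootFun (C : M) : botEdge (D.rootFun C) = ⟨0, 0, 0⟩ := rfl

end ResidueData

/-- The closed unit ball of an ultrametric normed field, as a subring. -/
def unitBallSubring (F : Type*) [NormedField F] [IsUltrametricDist F] : Subring F where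
  carrier := {x | ‖x‖ ≤ 1}
  mul_mem' {a b} ha hb := by
    simp only [Set.mem_ofPred_eq, norm_mul] at *
    exact mul_le_one₀ ha (norm_nonneg _) hb
  one_mem' := by simp
  add_mem' {a b} ha hb := (IsUltrametricDist.norm_add_le_max a b).trans (max_le ha hb)
  zero_mem' := by simp
  neg_mem' {a} ha := by simpa using ha

theorem mem_unitBallSubring {F : Type*} [NormedField F] [IsUltrametricDist F] {x : F} :
    x ∈ unitBallSubring F ↔ ‖x‖ ≤ 1 := Iff.rfl

theorem isUnit_unitBallSubring_iff {F : Type*} [NormedField F] [IsUltrametricDist F]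
    {x : unitBallSubring F} : IsUnit x ↔ ‖(x : F)‖ = 1 := by
  constructor
  · rintro ⟨u, rfl⟩
    have h1 : ‖((u : unitBallSubring F) : F)‖ ≤ 1 := u.1.2
    have h2 : ‖((u⁻¹ : (unitBallSubring F)ˣ) : unitBallSubring F).1‖ ≤ 1 := (u⁻¹).1.2
    have h3 : ‖((u : unitBallSubring F) : F)‖ * ‖((u⁻¹ : (unitBallSubring F)ˣ) : unitBallSubring F).1‖ = 1 := by
      rw [← norm_mul, ← Subring.coe_mul, Units.mul_inv]; simp
    apply le_antisymm h1
    rw [← h3]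
    exact mul_le_of_le_one_right (norm_nonneg _) h2
  · intro h
    have hx : (x : F) ≠ 0 := by
      intro h0; rw [h0, norm_zero] at h; exact zero_ne_one h
    refine IsUnit.of_mul_eq_one ⟨(x : F)⁻¹, ?_⟩ ?_
    · rw [mem_unitBallSubring, norm_inv, h, inv_one]
    · ext; simp [hx]

/-- The open unit ball, as an ideal of the closed unit ball. -/
def openBallIdeal (F : Type*) [NormedField F] [IsUltrametricDist F] :
    Ideal (unitBallSubring F) where
  carrier := {x | ‖(x : F)‖ < 1}
  add_mem' {a b} ha hb := by
    rw [Set.mem_ofPred_eq] at *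
    exact (IsUltrametricDist.norm_add_le_max (a : F) b).trans_lt (max_lt ha hb)
  zero_mem' := by simp
  smul_mem' c x hx := by
    simp only [Set.mem_ofPred_eq, smul_eq_mul, Subring.coe_mul, norm_mul] at *
    exact (mul_le_of_le_one_left (norm_nonneg _) c.2).trans_lt hx

theorem mem_openBallIdeal {F : Type*} [NormedField F] [IsUltrametricDist F]
    {x : unitBallSubring F} : x ∈ openBallIdeal F ↔ ‖(x : F)‖ < 1 := Iff.rfl

instance openBallIdeal_isMaximal (F : Type*) [NormedField F] [IsUltrametricDist F] :
    (openBallIdeal F).IsMaximal := by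
  rw [Ideal.isMaximal_iff]
  refine ⟨by simp [mem_openBallIdeal], fun J x _ hx hxJ => ?_⟩
  have hu : IsUnit x := by
    rw [isUnit_unitBallSubring_iff]
    rw [mem_openBallIdeal, not_lt] at hx
    exact le_antisymm x.2 hx
  rw [← Ideal.eq_top_iff_one]
  exact Ideal.eq_top_of_isUnit_mem J hxJ hu

/-- The residue field of the closed unit ball. -/
abbrev ResidueOf (F : Type*) [NormedField F] [IsUltrametricDist F] : Type _ :=
  unitBallSubring F ⧸ openBallIdeal F

noncomputable instance (F : Type*) [NormedField F] [IsUltrametricDist F] : Field (ResidueOf F) :=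
  Ideal.Quotient.field _

/-- The reduction map. -/
abbrev reduction (F : Type*) [NormedField F] [IsUltrametricDist F] :
    unitBallSubring F →+* ResidueOf F :=
  Ideal.Quotient.mk _

theorem reduction_eq_zero {F : Type*} [NormedField F] [IsUltrametricDist F]
    {x : unitBallSubring F} : reduction F x = 0 ↔ ‖(x : F)‖ < 1 := by
  rw [Ideal.Quotient.eq_zero_iff_mem, mem_openBallIdeal]

theorem norm_eq_one_of_pow_eq_one {F : Type*} [NormedField F] {x : F} {n : ℕ} (hn : n ≠ 0)
    (h : x ^ n = 1) : ‖x‖ = 1 := by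
  have : ‖x‖ ^ n = 1 := by rw [← norm_pow, h, norm_one]
  exact (pow_eq_one_iff_of_nonneg (norm_nonneg _) hn).1 this

theorem not_norm_sub_one_lt_one {F : Type*} [NormedField F] [IsUltrametricDist F] {x : F} {n : ℕ}
    (hn : ‖(n : F)‖ = 1) (h : x ^ n = 1) (hx : x ≠ 1) : ¬ ‖x - 1‖ < 1 := by
  intro hlt
  have hn0 : n ≠ 0 := by rintro rfl; simp at hn
  have hx1 : ‖x‖ ≤ 1 := (norm_eq_one_of_pow_eq_one hn0 h).le
  let y : unitBallSubring F := ⟨x, hx1⟩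
  have hy : reduction F y = 1 := by
    rw [← sub_eq_zero, ← map_one (reduction F), ← map_sub, reduction_eq_zero]
    exact hlt
  have hs : ∑ i ∈ Finset.range n, y ^ i = 0 := by
    have h1 := geom_sum_mul y n
    have h2 : y ^ n = 1 := by ext; simpa [y] using h
    rw [h2, sub_self] at h1
    rcases mul_eq_zero.1 h1 with h3 | h3
    · exact h3
    · exact absurd (congrArg Subtype.val (sub_eq_zero.1 h3)) hx
  have h3 := congrArg (reduction F) hs
  rw [map_sum, map_zero] at h3
  simp only [map_pow, hy, one_pow, Finset.sum_const, Finset.card_range, nsmul_eq_mul, mul_one] at h3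
  rw [← map_natCast (reduction F), reduction_eq_zero] at h3
  simp [hn] at h3

section Padic

variable {p : ℕ} [Fact p.Prime] {F : Type*} [NormedField F] [NormedAlgebra ℚ_[p] F]

theorem norm_natCast_eq_padic (n : ℕ) : ‖(n : F)‖ = ‖(n : ℚ_[p])‖ := by
  rw [← norm_algebraMap' F (n : ℚ_[p]), map_natCast]

theorem isUltrametricDist_of_padic (p : ℕ) [Fact p.Prime] (F : Type*) [NormedField F]
    [NormedAlgebra ℚ_[p] F] : IsUltrametricDist F :=
  IsUltrametricDist.isUltrametricDist_of_forall_norm_natCast_le_one fun n => by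
    rw [norm_natCast_eq_padic (p := p)]
    exact_mod_cast (n : ℤ_[p]).2

variable (p F) in
theorem norm_prime_eq : ‖(p : F)‖ = (p : ℝ)⁻¹ := by
  rw [norm_natCast_eq_padic (p := p), Padic.norm_p]

variable (p F) in
theorem norm_prime_lt_one : ‖(p : F)‖ < 1 := by
  rw [norm_prime_eq]
  exact inv_lt_one_of_one_lt₀ (by exact_mod_cast (Fact.out : p.Prime).one_lt)

theorem exists_natCast_reduction (a : ℚ_[p]) (ha : ‖a‖ ≤ 1) :
    ∃ n : ℕ, n < p ∧ ‖algebraMap ℚ_[p] F a - n‖ < 1 := by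
  obtain ⟨n, hn, h⟩ := PadicInt.exists_mem_range (⟨a, ha⟩ : ℤ_[p])
  refine ⟨n, hn, ?_⟩
  rw [PadicInt.maximalIdeal_eq_span_p, Ideal.mem_span_singleton, ← PadicInt.norm_lt_one_iff_dvd] at h
  rw [← map_natCast (algebraMap ℚ_[p] F), ← map_sub, norm_algebraMap']
  exact h

theorem norm_pred_sq : ‖((p ^ 2 - 1 : ℕ) : F)‖ = 1 := by
  have hp : 1 < p := (Fact.out : p.Prime).one_lt
  rw [norm_natCast_eq_padic (p := p)]
  have h1 : ¬ p ∣ p ^ 2 - 1 := by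
    intro h
    have h2 : p ∣ p ^ 2 := dvd_pow_self p two_ne_zero
    have h3 : p ∣ 1 := by
      have h4 := Nat.dvd_sub h2 h
      rwa [Nat.sub_sub_self (Nat.one_le_pow _ _ (by omega))] at h4
    exact absurd (Nat.le_of_dvd one_pos h3) (by omega)
  have h2 := (PadicInt.norm_int_lt_one_iff_dvd (p := p) ((p ^ 2 - 1 : ℕ) : ℤ)).not.2
    (by exact_mod_cast h1)
  rw [not_lt] at h2
  refine le_antisymm ?_ ?_
  · exact_mod_cast ((p ^ 2 - 1 : ℕ) : ℤ_[p]).2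
  · have h3 : ‖(((p ^ 2 - 1 : ℕ) : ℤ) : ℤ_[p])‖ = ‖((p ^ 2 - 1 : ℕ) : ℚ_[p])‖ := by
      rw [PadicInt.norm_def]; simp
    rw [← h3]; exact h2

theorem primitive_norm {ζ : F} (hζ : IsPrimitiveRoot ζ (p ^ 2 - 1)) : ‖ζ‖ = 1 := by
  refine norm_eq_one_of_pow_eq_one ?_ hζ.pow_eq_one
  intro h0
  have := norm_pred_sq (p := p) (F := F)
  rw [h0] at this; simp at this

variable [IsUltrametricDist F]

variable (p F) in
theorem residue_charP : CharP (ResidueOf F) p := by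
  have h : ((p : ℕ) : ResidueOf F) = 0 := by
    rw [← map_natCast (reduction F), reduction_eq_zero]
    simpa using norm_prime_lt_one p F
  exact (CharP.charP_iff_prime_eq_zero Fact.out).2 h

theorem pow_sub_ne_one {ζ : F} (hζ : IsPrimitiveRoot ζ (p ^ 2 - 1)) {i : ℕ} (hi : i ≠ 0)
    (hi' : i < p ^ 2 - 1) : ¬ ‖ζ ^ i - 1‖ < 1 := by
  refine not_norm_sub_one_lt_one (n := p ^ 2 - 1) norm_pred_sq ?_ ?_
  · rw [← pow_mul, mul_comm, pow_mul, hζ.pow_eq_one, one_pow]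
  · exact hζ.pow_ne_one_of_pos_of_lt hi hi'

theorem not_norm_add_primitive_lt_one {ζ : F} (hζ : IsPrimitiveRoot ζ (p ^ 2 - 1)) (c : ℚ_[p])
    (hc : ‖c‖ ≤ 1) : ¬ ‖algebraMap ℚ_[p] F c + ζ‖ < 1 := by
  intro hlt
  have hp : 1 < p := (Fact.out : p.Prime).one_lt
  have := residue_charP p F
  obtain ⟨n, -, hn⟩ := exists_natCast_reduction (F := F) (-c) (by rwa [norm_neg])
  let z : unitBallSubring F := ⟨ζ, (primitive_norm hζ).le⟩
  have h1 : reduction F z = n := by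
    rw [← map_natCast (reduction F), ← sub_eq_zero, ← map_sub, reduction_eq_zero]
    have : ((z - (n : unitBallSubring F) : unitBallSubring F) : F) =
        (algebraMap ℚ_[p] F c + ζ) + (algebraMap ℚ_[p] F (-c) - n) := by
      simp [z]; ring
    rw [this]
    exact (IsUltrametricDist.norm_add_le_max _ _).trans_lt (max_lt hlt hn)
  have h2 : reduction F z ^ p = reduction F z := by
    rw [h1, ← frobenius_def, map_natCast]
  have hz0 : reduction F z ≠ 0 := by
    rw [Ne, reduction_eq_zero]; simp [z, primitive_norm hζ]
  have h3 : reduction F z ^ (p - 1) = 1 := by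
    have : reduction F z * reduction F z ^ (p - 1) = reduction F z * 1 := by
      rw [← pow_succ', Nat.sub_add_cancel hp.le, h2, mul_one]
    exact mul_left_cancel₀ hz0 this
  refine pow_sub_ne_one hζ (i := p - 1) (by omega) ?_ ?_
  · have : p < p ^ 2 := by nlinarith
    omega
  · have : reduction F (z ^ (p - 1) - 1) = 0 := by rw [map_sub, map_pow, h3, map_one, sub_self]
    rw [reduction_eq_zero] at this
    simpa [z] using this

theorem norm_add_mul_primitive {ζ : F} (hζ : IsPrimitiveRoot ζ (p ^ 2 - 1)) (a b : ℚ_[p]) :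
    ‖algebraMap ℚ_[p] F a + algebraMap ℚ_[p] F b * ζ‖ = max ‖a‖ ‖b‖ := by
  have hb' : ‖algebraMap ℚ_[p] F b * ζ‖ = ‖b‖ := by
    rw [norm_mul, primitive_norm hζ, mul_one, norm_algebraMap']
  by_cases hab : ‖a‖ = ‖b‖
  · by_cases hb : b = 0
    · subst hb
      have : a = 0 := by simpa using hab
      simp [this]
    have hb0 : ‖b‖ ≠ 0 := by simpa using hb
    have hc : ‖a / b‖ = 1 := by rw [norm_div, hab, div_self hb0]
    have hB : algebraMap ℚ_[p] F b ≠ 0 := by simpa using hb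
    have h1 := not_norm_add_primitive_lt_one hζ (a / b) hc.le
    have h2 : ‖algebraMap ℚ_[p] F (a / b) + ζ‖ ≤ 1 :=
      (IsUltrametricDist.norm_add_le_max _ _).trans
        (by rw [norm_algebraMap', hc, primitive_norm hζ, max_self])
    have h3 : algebraMap ℚ_[p] F a + algebraMap ℚ_[p] F b * ζ =
        algebraMap ℚ_[p] F b * (algebraMap ℚ_[p] F (a / b) + ζ) := by
      rw [map_div₀]; field_simp
    rw [h3, norm_mul, le_antisymm h2 (not_lt.1 h1), mul_one, norm_algebraMap', hab, max_self]
  · rw [IsUltrametricDist.norm_add_eq_max_of_norm_ne_norm, hb', norm_algebraMap']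
    rwa [hb', norm_algebraMap']

theorem exists_eq_add_mul_primitive [FiniteDimensional ℚ_[p] F] (hdeg : Module.finrank ℚ_[p] F = 2) {ζ : F}
    (hζ : IsPrimitiveRoot ζ (p ^ 2 - 1)) (x : F) :
    ∃ a b : ℚ_[p], x = algebraMap ℚ_[p] F a + algebraMap ℚ_[p] F b * ζ := by
  have hli : LinearIndependent ℚ_[p] ![(1 : F), ζ] := by
    rw [LinearIndependent.pair_iff]
    intro s t h
    have h1 := norm_add_mul_primitive hζ s t
    rw [Algebra.smul_def, Algebra.smul_def, mul_one] at h
    rw [h, norm_zero] at h1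
    constructor
    · exact norm_le_zero_iff.1 (h1 ▸ le_max_left _ _)
    · exact norm_le_zero_iff.1 (h1 ▸ le_max_right _ _)
  have hsp := hli.span_eq_top_of_card_eq_finrank' (by simp [hdeg])
  have hx : x ∈ Submodule.span ℚ_[p] (Set.range ![(1 : F), ζ]) := by rw [hsp]; trivial
  rw [Matrix.range_cons, Matrix.range_cons, Matrix.range_empty, Set.union_empty,
    Set.singleton_union, Submodule.mem_span_pair] at hx
  obtain ⟨a, b, h⟩ := hx
  exact ⟨a, b, by rw [← h, Algebra.smul_def, Algebra.smul_def, mul_one]⟩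

theorem exists_norm_eq_zpow [FiniteDimensional ℚ_[p] F] (hdeg : Module.finrank ℚ_[p] F = 2) {ζ : F}
    (hζ : IsPrimitiveRoot ζ (p ^ 2 - 1)) {x : F} (hx : x ≠ 0) : ∃ n : ℤ, ‖x‖ = ‖(p : F)‖ ^ n := by
  obtain ⟨a, b, rfl⟩ := exists_eq_add_mul_primitive hdeg hζ x
  have h0 : max ‖a‖ ‖b‖ ≠ 0 := by rw [← norm_add_mul_primitive hζ]; simpa using hx
  rw [norm_add_mul_primitive hζ, norm_prime_eq]
  have key : ∀ c : ℚ_[p], ‖c‖ ≠ 0 → ∃ n : ℤ, ‖c‖ = (p : ℝ)⁻¹ ^ n := fun c hc =>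
    ⟨c.valuation, by rw [Padic.norm_eq_zpow_neg_valuation (by simpa using hc)]; simp⟩
  rcases max_choice ‖a‖ ‖b‖ with h | h <;> rw [h] at h0 ⊢ <;> exact key _ h0

theorem residue_card [FiniteDimensional ℚ_[p] F] (hdeg : Module.finrank ℚ_[p] F = 2) {ζ : F}
    (hζ : IsPrimitiveRoot ζ (p ^ 2 - 1)) :
    Finite (ResidueOf F) ∧ Nat.card (ResidueOf F) = p ^ 2 := by
  have hp : 1 < p := (Fact.out : p.Prime).one_lt
  let z : unitBallSubring F := ⟨ζ, (primitive_norm hζ).le⟩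
  let f : Fin p × Fin p → ResidueOf F := fun t => reduction F ((t.1 : ℕ) + (t.2 : ℕ) * z)
  have hf : Function.Surjective f := by
    intro y
    obtain ⟨x, rfl⟩ := Ideal.Quotient.mk_surjective y
    obtain ⟨a, b, hab⟩ := exists_eq_add_mul_primitive hdeg hζ (x : F)
    have hx1 : ‖(x : F)‖ ≤ 1 := x.2
    rw [hab, norm_add_mul_primitive hζ] at hx1
    obtain ⟨m, hm, hm'⟩ := exists_natCast_reduction (F := F) a ((le_max_left _ _).trans hx1)
    obtain ⟨n, hn, hn'⟩ := exists_natCast_reduction (F := F) b ((le_max_right _ _).trans hx1)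
    refine ⟨(⟨m, hm⟩, ⟨n, hn⟩), ?_⟩
    rw [eq_comm, ← sub_eq_zero, ← map_sub, reduction_eq_zero]
    have : ((x - ((m : unitBallSubring F) + n * z) : unitBallSubring F) : F) =
        (algebraMap ℚ_[p] F a - m) + (algebraMap ℚ_[p] F b - n) * ζ := by
      simp [z, hab]; ring
    simp only
    rw [this]
    refine (IsUltrametricDist.norm_add_le_max _ _).trans_lt (max_lt hm' ?_)
    rwa [norm_mul, primitive_norm hζ, mul_one]
  have hfin : Finite (ResidueOf F) := Finite.of_surjective f hf
  refine ⟨hfin, le_antisymm ?_ ?_⟩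
  · have := Nat.card_le_card_of_surjective f hf
    simpa [sq] using this
  · have hz0 : reduction F z ≠ 0 := by
      rw [Ne, reduction_eq_zero]; simp [z, primitive_norm hζ]
    let g : Option (Fin (p ^ 2 - 1)) → ResidueOf F := fun o => o.elim 0 fun i => reduction F z ^ (i : ℕ)
    have hlt : ∀ i j : ℕ, i < j → j < p ^ 2 - 1 → reduction F z ^ i ≠ reduction F z ^ j := by
      intro i j hij hj h
      have h1 : reduction F z ^ (j - i) = 1 := by
        have : reduction F z ^ i * reduction F z ^ (j - i) = reduction F z ^ i * 1 := by
          rw [← pow_add, mul_one, h]; congr 1; omega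
        exact mul_left_cancel₀ (pow_ne_zero _ hz0) this
      refine pow_sub_ne_one hζ (i := j - i) (by omega) (by omega) ?_
      have : reduction F (z ^ (j - i) - 1) = 0 := by rw [map_sub, map_pow, h1, map_one, sub_self]
      rw [reduction_eq_zero] at this
      simpa [z] using this
    have hg : Function.Injective g := by
      rintro (_ | i) (_ | j) h
      · rfl
      · exact absurd h.symm (pow_ne_zero _ hz0)
      · exact absurd h (pow_ne_zero _ hz0)
      · congr 1
        rcases lt_trichotomy (i : ℕ) j with hij | hij | hij
        · exact absurd h (hlt _ _ hij j.2)
        · exact Fin.ext hij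
        · exact absurd h.symm (hlt _ _ hij i.2)
    have := Nat.card_le_card_of_injective g hg
    rw [Nat.card_eq_fintype_card, Fintype.card_option, Fintype.card_fin,
      Nat.sub_add_cancel (Nat.one_le_pow _ _ (by omega))] at this
    exact this

end Padic

/-- Functions on `GL (Fin 2) O` with values at two edges, that can be prescribed freely. -/
structure TreeData (p : ℕ) (O X E : Type*) [CommRing O] where
  /-- admissible functions -/
  Q : (GL (Fin 2) O → X) → Prop
  /-- value at the first edge -/
  top : (GL (Fin 2) O → X) → E
  /-- value at the second edge -/
  bot : (GL (Fin 2) O → X) → E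
  /-- the action on edge values -/
  act : O → O → O → E → E
  /-- the extension to a vertex -/
  ext : E → E → GL (Fin 2) O → X
  /-- the admissible function at the root -/
  root : GL (Fin 2) O → X
  /-- the default value -/
  zero : X
  Q_mul : ∀ f i, Q f → Q (fun κ => f (i * κ))
  top_mul : ∀ f (i : GL (Fin 2) O) c, Q f → i 1 0 = p * c →
    top (fun κ => f (i * κ)) = act (i 0 0) (i 0 1) (i 1 1) (top f)
  bot_mul : ∀ f (i : GL (Fin 2) O) c, Q f → i 1 0 = p * c →
    bot (fun κ => f (i * κ)) = act (i 1 1) c (i 0 0) (bot f)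
  Q_ext : ∀ e e', Q (ext e e')
  top_ext : ∀ e e', top (ext e e') = e
  bot_ext : ∀ e e', bot (ext e e') = e'
  Q_root : Q root
  Q_zero : Q (fun _ => zero)
  top_root : top root = top (fun _ => zero)
  bot_root : bot root = top (fun _ => zero)
  bot_zero : bot (fun _ => zero) = top (fun _ => zero)

theorem AddSubgroup.exists_representative {A : Type*} [AddCommGroup A] (S : AddSubgroup A) :
    ∃ c : A → A, (∀ b, b - c b ∈ S) ∧ ∀ b, ∀ a ∈ S, c (b + a) = c b := by
  refine ⟨fun b => (QuotientAddGroup.mk (s := S) b).out, fun b => ?_, fun b a ha => ?_⟩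
  · have h : (QuotientAddGroup.mk (s := S) (QuotientAddGroup.mk (s := S) b).out) =
      QuotientAddGroup.mk b := QuotientAddGroup.out_eq' _
    rw [QuotientAddGroup.eq] at h
    rwa [sub_eq_neg_add]
  · have : (QuotientAddGroup.mk (b + a) : A ⧸ S) = QuotientAddGroup.mk b :=
      QuotientAddGroup.mk_add_of_mem b ha
    simp only [this]

theorem upperGL_add {R : Type*} [CommRing R] (a b : R) :
    upperGL (a + b) = upperGL a * upperGL b := by
  apply GL2_ext <;> simp [GL2_mul_apply, add_comm]

theorem upperGL_mul_swapGL {R : Type*} [CommRing R] (a : R) :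
    upperGL a * swapGL 0 = swapGL 0 * lowerGL a := by
  apply GL2_ext <;> simp only [GL2_mul_apply] <;> simp

namespace TreeData

variable {p : ℕ} {F : Type*} [NormedField F] [IsUltrametricDist F] {X E : Type*}
  (T : TreeData p (unitBallSubring F) X E)

/-- Compatibility of a family of functions on `GL (Fin 2) O` on a level of the tree. -/
def Level (n : ℤ) (R : F → GL (Fin 2) (unitBallSubring F) → X) : Prop :=
  (∀ b, T.Q (R b)) ∧ ∀ b (β : unitBallSubring F) κ, R (b + p ^ n * β) κ = R b (upperGL β * κ)

/-- Compatibility of two successive levels. -/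
def Linked (R R' : F → GL (Fin 2) (unitBallSubring F) → X) : Prop :=
  ∀ b, T.top (R' b) = T.bot (fun κ => R b (swapGL 0 * κ)) ∧
    T.bot (R' b) = T.top (fun κ => R b (swapGL 0 * κ))

variable {T}

theorem exists_next_level (hp : (p : F) ≠ 0) {n : ℤ}
    {R : F → GL (Fin 2) (unitBallSubring F) → X} (hR : T.Level n R) :
    ∃ R', T.Level (n + 1) R' ∧ T.Linked R R' := by
  have hpn : (p : F) ^ (n + 1) ≠ 0 := zpow_ne_zero _ hp
  let S : AddSubgroup F :=
    ((AddMonoidHom.mulLeft ((p : F) ^ (n + 1))).comp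
      (unitBallSubring F).subtype.toAddMonoidHom).range
  obtain ⟨c, hc, hc'⟩ := S.exists_representative
  choose β hβ using hc
  have hβ' : ∀ b, b = c b + p ^ (n + 1) * (β b : F) := fun b => by
    have h : (p : F) ^ (n + 1) * (β b : F) = b - c b := hβ b
    rw [h]; ring
  have hcadd : ∀ b (γ : unitBallSubring F), c (b + p ^ (n + 1) * γ) = c b :=
    fun b γ => hc' b _ ⟨γ, rfl⟩
  have hβadd : ∀ b (γ : unitBallSubring F), β (b + p ^ (n + 1) * γ) = β b + γ := fun b γ => by
    have h := hβ' (b + p ^ (n + 1) * γ)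
    rw [hcadd] at h
    apply Subtype.ext
    apply mul_left_cancel₀ hpn
    have h2 := hβ' b
    push_cast
    linear_combination h2 - h
  let f : F → GL (Fin 2) (unitBallSubring F) → X := fun b κ => R b (swapGL 0 * κ)
  have hf : ∀ b, T.Q (f b) := fun b => T.Q_mul _ _ (hR.1 b)
  have hfb : ∀ b, f b = fun κ => f (c b) (lowerGL (p * β b) * κ) := fun b => by
    funext κ
    have h := hR.2 (c b) (p * β b) (swapGL 0 * κ)
    have h3 : c b + (p : F) ^ n * ((p * β b : unitBallSubring F) : F) = b := by
      conv_rhs => rw [hβ' b, zpow_add_one₀ hp]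
      push_cast
      ring
    rw [h3] at h
    change R b _ = R (c b) _
    rw [h, ← mul_assoc, upperGL_mul_swapGL, mul_assoc]
  let e := fun b => T.ext (T.bot (f (c b))) (T.top (f (c b)))
  refine ⟨fun b κ => e b (upperGL (β b) * κ),
    ⟨fun b => T.Q_mul _ _ (T.Q_ext _ _), fun b γ κ => ?_⟩, fun b => ⟨?_, ?_⟩⟩
  · simp only [e, hcadd, hβadd, upperGL_add, mul_assoc]
  · rw [T.top_mul _ _ 0 (T.Q_ext _ _) (by simp), T.top_ext]
    change _ = T.bot (f b)
    rw [hfb b, T.bot_mul _ _ (β b) (hf _) (by simp)]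
    simp
  · rw [T.bot_mul _ _ 0 (T.Q_ext _ _) (by simp), T.bot_ext]
    change _ = T.top (f b)
    rw [hfb b, T.top_mul _ _ (β b) (hf _) (by simp)]
    simp

theorem level_zero (n : ℤ) : T.Level n (fun _ _ => T.zero) :=
  ⟨fun _ => T.Q_zero, fun _ _ _ => rfl⟩

theorem linked_zero : T.Linked (fun _ _ => T.zero) (fun _ _ => T.zero) := fun _ =>
  ⟨T.bot_zero.symm, T.bot_zero⟩

theorem exists_root_level (T : TreeData p (unitBallSubring F) X E) :
    ∃ R : F → GL (Fin 2) (unitBallSubring F) → X, T.Level 0 R ∧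
      T.Linked (fun _ _ => T.zero) R ∧ R 0 = T.root := by
  classical
  let R : F → GL (Fin 2) (unitBallSubring F) → X := fun b κ =>
    if h : b ∈ unitBallSubring F then T.root (upperGL ⟨b, h⟩ * κ) else T.zero
  have h1 : ∀ b (h : b ∈ unitBallSubring F), R b = fun κ => T.root (upperGL ⟨b, h⟩ * κ) :=
    fun b h => by funext κ; simp only [R, dif_pos h]
  have h2 : ∀ b, b ∉ unitBallSubring F → R b = fun κ => T.zero :=
    fun b h => by funext κ; simp only [R, dif_neg h]
  have hz := T.top_mul (fun _ => T.zero)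
  have hz' := T.bot_mul (fun _ => T.zero)
  refine ⟨R, ⟨fun b => ?_, fun b β κ => ?_⟩, fun b => ?_, ?_⟩
  · by_cases h : b ∈ unitBallSubring F
    · rw [h1 b h]; exact T.Q_mul _ _ T.Q_root
    · rw [h2 b h]; exact T.Q_zero
  · rw [zpow_zero, one_mul]
    by_cases h : b ∈ unitBallSubring F
    · rw [h1 b h, h1 _ (add_mem h β.2)]
      change T.root _ = T.root _
      rw [← mul_assoc, ← upperGL_add]
      rfl
    · rw [h2 b h, h2 _ fun h3 => h (by simpa using sub_mem h3 β.2)]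
  · by_cases h : b ∈ unitBallSubring F
    · rw [h1 b h]
      constructor
      · rw [T.top_mul _ _ 0 T.Q_root (by simp), T.top_root, T.bot_zero]
        exact (hz (upperGL ⟨b, h⟩) 0 T.Q_zero (by simp)).symm
      · rw [T.bot_mul _ _ 0 T.Q_root (by simp), T.bot_root, ← T.bot_zero]
        rw [← hz' (upperGL ⟨b, h⟩) 0 T.Q_zero (by simp), T.bot_zero]
    · rw [h2 b h]
      exact linked_zero b
  · rw [h1 0 (zero_mem _)]
    funext κ
    have : upperGL (⟨0, zero_mem _⟩ : unitBallSubring F) = 1 := by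
      apply GL2_ext <;> simp
    rw [this, one_mul]

theorem exists_levels (T : TreeData p (unitBallSubring F) X E) (hp : (p : F) ≠ 0) :
    ∃ R : ℤ → F → GL (Fin 2) (unitBallSubring F) → X, (∀ n, T.Level n (R n)) ∧
      (∀ n, T.Linked (R n) (R (n + 1))) ∧ R 0 0 = T.root := by
  obtain ⟨R₀, hR₀, hlink, hroot⟩ := T.exists_root_level
  let seq : ∀ n : ℕ, {R // T.Level (n : ℤ) R} := fun n =>
    Nat.rec ⟨R₀, hR₀⟩ (fun n R => ⟨_, (exists_next_level hp R.2).choose_spec.1⟩) n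
  have hseq : ∀ n, T.Linked (seq n).1 (seq (n + 1)).1 := fun n =>
    (exists_next_level hp (seq n).2).choose_spec.2
  refine ⟨fun n => match n with
    | Int.ofNat n => (seq n).1
    | Int.negSucc _ => fun _ _ => T.zero, fun n => ?_, fun n => ?_, hroot⟩
  · cases n with
    | ofNat n => exact (seq n).2
    | negSucc n => exact level_zero _
  · match n with
    | Int.ofNat n => exact hseq n
    | Int.negSucc 0 => exact hlink
    | Int.negSucc (n + 1) => exact linked_zero

end TreeData

section Decomposition

variable {F : Type*} [NormedField F]

section Generators

variable {p : ℕ} (hp : (p : F) ≠ 0)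

/-- The matrix `[0, 1; p, 0]`. -/
def piGL : GL (Fin 2) F :=
  Matrix.GeneralLinearGroup.mkOfDetNeZero !![0, 1; (p : F), 0] (by simpa using hp)

/-- The scalar matrix `p`. -/
def scalarGL : GL (Fin 2) F :=
  Matrix.GeneralLinearGroup.mkOfDetNeZero !![(p : F), 0; 0, (p : F)] (by simpa using hp)

/-- The matrix `p ^ z * [p ^ n, b; 0, 1]`. -/
def affineGL (z n : ℤ) (b : F) : GL (Fin 2) F :=
  Matrix.GeneralLinearGroup.mkOfDetNeZero !![(p : F) ^ (z + n), (p : F) ^ z * b; 0, (p : F) ^ z]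
    (by simp [zpow_ne_zero _ hp])

@[simp] theorem coe_piGL : (piGL hp : Matrix _ _ F) = !![0, 1; (p : F), 0] := rfl
@[simp] theorem coe_scalarGL : (scalarGL hp : Matrix _ _ F) = !![(p : F), 0; 0, (p : F)] := rfl
@[simp] theorem coe_affineGL (z n : ℤ) (b : F) : (affineGL hp z n b : Matrix _ _ F) =
  !![(p : F) ^ (z + n), (p : F) ^ z * b; 0, (p : F) ^ z] := rfl

theorem scalarGL_mul_affineGL (z n : ℤ) (b : F) :
    scalarGL hp * affineGL hp z n b = affineGL hp (z + 1) n b := by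
  apply GL2_ext <;> simp only [GL2_mul_apply] <;> simp [zpow_add₀ hp] <;> ring

theorem scalarGL_mul_comm (g : GL (Fin 2) F) : scalarGL hp * g = g * scalarGL hp := by
  apply GL2_ext <;> simp only [GL2_mul_apply] <;> simp <;> ring

theorem piGL_mul_self : piGL hp * piGL hp = scalarGL hp := by
  apply GL2_ext <;> simp only [GL2_mul_apply] <;> simp

end Generators

variable [IsUltrametricDist F]

/-- The inclusion of the integral matrices. -/
def integralGL (F : Type*) [NormedField F] [IsUltrametricDist F] :
    GL (Fin 2) (unitBallSubring F) →* GL (Fin 2) F :=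
  Matrix.GeneralLinearGroup.map (unitBallSubring F).subtype

@[simp] theorem integralGL_apply (κ : GL (Fin 2) (unitBallSubring F)) (i j : Fin 2) :
    integralGL F κ i j = (κ i j : F) := rfl

theorem exists_integralGL {g : GL (Fin 2) F} (h : ∀ i j, ‖g i j‖ ≤ 1) (hdet : ‖det2 g‖ = 1) :
    ∃ κ, integralGL F κ = g := by
  let A : Matrix (Fin 2) (Fin 2) (unitBallSubring F) := fun i j => ⟨g i j, h i j⟩
  have hA : IsUnit A.det := by
    rw [isUnit_unitBallSubring_iff, Matrix.det_fin_two]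
    exact hdet
  exact ⟨Matrix.GeneralLinearGroup.mk'' A hA, GL2_ext rfl rfl rfl rfl⟩

variable {p : ℕ} (hp : (p : F) ≠ 0)

theorem affineGL_mul_swap_mul_piGL (z n : ℤ) (b : F) :
    affineGL hp z n b * integralGL F (swapGL 0) * piGL hp = affineGL hp z (n + 1) b := by
  apply GL2_ext <;> simp only [GL2_mul_apply] <;> simp [← add_assoc, zpow_add_one₀ hp]

theorem affineGL_mul_upperGL (z n : ℤ) (b : F) (β : unitBallSubring F) :
    affineGL hp z n b * integralGL F (upperGL β) = affineGL hp z n (b + p ^ n * β) := by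
  apply GL2_ext <;> simp only [GL2_mul_apply] <;> simp [zpow_add₀ hp]
  ring

theorem integralGL_mul_piGL {i : GL (Fin 2) (unitBallSubring F)} {c : unitBallSubring F}
    (hi : i 1 0 = p * c) : ∃ i' : GL (Fin 2) (unitBallSubring F),
      integralGL F i * piGL hp = piGL hp * integralGL F i' ∧
      i' 0 0 = i 1 1 ∧ i' 0 1 = c ∧ i' 1 0 = p * i 0 1 ∧ i' 1 1 = i 0 0 := by
  have hdet := isUnit_det2 i
  obtain ⟨i', h00, h01, h10, h11⟩ : ∃ i' : GL (Fin 2) (unitBallSubring F),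
      i' 0 0 = i 1 1 ∧ i' 0 1 = c ∧ i' 1 0 = p * i 0 1 ∧ i' 1 1 = i 0 0 := by
    refine ⟨Matrix.GeneralLinearGroup.mk'' !![i 1 1, c; p * i 0 1, i 0 0] ?_, rfl, rfl, rfl, rfl⟩
    rw [Matrix.det_fin_two_of]
    convert hdet using 1
    rw [det2, hi]; ring
  refine ⟨i', ?_, h00, h01, h10, h11⟩
  apply GL2_ext <;> simp only [GL2_mul_apply, integralGL_apply, hi, h00, h01, h10, h11] <;>
    simp [mul_comm]

theorem exists_affineGL_mul (hval : ∀ x : F, x ≠ 0 → ∃ n : ℤ, ‖x‖ = ‖(p : F)‖ ^ n)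
    (g : GL (Fin 2) F) : ∃ z n b κ, g = affineGL hp z n b * integralGL F κ := by
  suffices H : ∀ g : GL (Fin 2) F, ‖g 1 0‖ ≤ ‖g 1 1‖ →
      ∃ z n b κ, g = affineGL hp z n b * integralGL F κ by
    rcases le_total ‖g 1 0‖ ‖g 1 1‖ with h | h
    · exact H g h
    · obtain ⟨z, n, b, κ, hκ⟩ := H (g * integralGL F (swapGL 0)) (by
        simp only [GL2_mul_apply]; simpa using h)
      refine ⟨z, n, b, κ * (swapGL 0)⁻¹, ?_⟩
      rw [map_mul, ← mul_assoc, ← hκ, map_inv, mul_inv_cancel_right]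
  intro g h
  have hdet : det2 g ≠ 0 := (isUnit_det2 g).ne_zero
  have hd : g 1 1 ≠ 0 := by
    intro h0
    rw [h0, norm_zero, norm_le_zero_iff] at h
    exact hdet (by rw [det2, h0, h]; ring)
  obtain ⟨m, hm⟩ := hval (det2 g / g 1 1) (div_ne_zero hdet hd)
  obtain ⟨z, hz⟩ := hval _ hd
  have hp0 : ‖(p : F)‖ ≠ 0 := norm_ne_zero_iff.2 hp
  have hpm := zpow_ne_zero m hp
  have hpz := zpow_ne_zero z hp
  have hu : ‖det2 g / g 1 1 / p ^ m‖ = 1 := by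
    rw [norm_div, hm, norm_zpow, div_self (zpow_ne_zero _ hp0)]
  have hv : ‖g 1 1 / p ^ z‖ = 1 := by
    rw [norm_div, hz, norm_zpow, div_self (zpow_ne_zero _ hp0)]
  have hw : ‖g 1 0 / p ^ z‖ ≤ 1 := by
    rw [norm_div, norm_zpow, ← hz]
    exact div_le_one_of_le₀ h (norm_nonneg _)
  have hne : det2 g / g 1 1 / p ^ m * (g 1 1 / p ^ z) ≠ 0 := by
    rw [← norm_ne_zero_iff, norm_mul, hu, hv]; norm_num
  let k₀ : GL (Fin 2) F := Matrix.GeneralLinearGroup.mkOfDetNeZero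
    !![det2 g / g 1 1 / p ^ m, 0; g 1 0 / p ^ z, g 1 1 / p ^ z] (by simpa using hne)
  obtain ⟨κ, hκ⟩ := exists_integralGL (g := k₀) (by
      intro i j
      fin_cases i <;> fin_cases j
      · exact hu.le
      · simp [k₀]
      · exact hw
      · exact hv.le) (by
      have : det2 k₀ = det2 g / g 1 1 / p ^ m * (g 1 1 / p ^ z) := by simp [det2, k₀]
      rw [this, norm_mul, hu, hv, mul_one])
  refine ⟨z, m - z, g 0 1 / g 1 1, κ, ?_⟩
  rw [hκ]
  apply GL2_ext <;> simp only [GL2_mul_apply] <;> simp [k₀] <;> field_simp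
  simp [det2]

theorem affineGL_inj (hlt : ‖(p : F)‖ < 1) {z n z' n' : ℤ} {b b' : F}
    {i : GL (Fin 2) (unitBallSubring F)}
    (h : affineGL hp z n b * integralGL F i = affineGL hp z' n' b') :
    z = z' ∧ n = n' ∧ ∃ β, i = upperGL β ∧ b' = b + p ^ n * β := by
  have hpp : 0 < ‖(p : F)‖ := norm_pos_iff.2 hp
  have h00 := congrArg (fun g : GL (Fin 2) F => g 0 0) h
  have h01 := congrArg (fun g : GL (Fin 2) F => g 0 1) h
  have h10 := congrArg (fun g : GL (Fin 2) F => g 1 0) h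
  have h11 := congrArg (fun g : GL (Fin 2) F => g 1 1) h
  simp only [GL2_mul_apply, coe_affineGL, integralGL_apply] at h00 h01 h10 h11
  simp only [of_apply, cons_val', cons_val_zero, cons_val_one, cons_val_fin_one, zero_mul,
    zero_add] at h00 h01 h10 h11
  have e10 : ((i 1 0 : unitBallSubring F) : F) = 0 :=
    (mul_eq_zero.1 h10).resolve_left (zpow_ne_zero _ hp)
  have e10' : i 1 0 = 0 := Subtype.ext e10
  have hdet := isUnit_det2 i
  rw [det2, e10', mul_zero, sub_zero] at hdet
  have hn0 := isUnit_unitBallSubring_iff.1 (isUnit_of_mul_isUnit_left hdet)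
  have hn1 := isUnit_unitBallSubring_iff.1 (isUnit_of_mul_isUnit_right hdet)
  have hz : z = z' := by
    have := congrArg norm h11
    rw [norm_mul, hn1, mul_one, norm_zpow, norm_zpow] at this
    exact zpow_right_injective₀ hpp hlt.ne this
  subst hz
  rw [e10, mul_zero, add_zero] at h00
  have hn : n = n' := by
    have := congrArg norm h00
    rw [norm_mul, hn0, mul_one, norm_zpow, norm_zpow] at this
    exact add_left_cancel (zpow_right_injective₀ hpp hlt.ne this)
  subst hn
  have e11 : ((i 1 1 : unitBallSubring F) : F) = 1 :=
    mul_left_cancel₀ (zpow_ne_zero z hp) (by rw [h11, mul_one])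
  have e00 : ((i 0 0 : unitBallSubring F) : F) = 1 :=
    mul_left_cancel₀ (zpow_ne_zero (z + n) hp) (by rw [h00, mul_one])
  refine ⟨rfl, rfl, i 0 1, ?_, ?_⟩
  · apply GL2_ext <;> simp [e10']
    · exact Subtype.ext e00
    · exact Subtype.ext e11
  · rw [e11, zpow_add₀ hp] at h01
    apply mul_left_cancel₀ (zpow_ne_zero z hp)
    rw [← h01]; ring

end Decomposition

namespace TreeData

variable {p : ℕ} {F : Type*} [NormedField F] [IsUltrametricDist F] {X E : Type*}
  {T : TreeData p (unitBallSubring F) X E}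

/-- Compatibility of a function on `GL (Fin 2) F` along the edge attached to `g`. -/
def EdgeCompat (T : TreeData p (unitBallSubring F) X E) (hp : (p : F) ≠ 0)
    (Φ : GL (Fin 2) F → X) (g : GL (Fin 2) F) : Prop :=
  T.top (fun κ => Φ (g * piGL hp * integralGL F κ)) = T.bot (fun κ => Φ (g * integralGL F κ)) ∧
  T.bot (fun κ => Φ (g * piGL hp * integralGL F κ)) = T.top (fun κ => Φ (g * integralGL F κ))

theorem EdgeCompat.mul_integralGL {hp : (p : F) ≠ 0} {Φ : GL (Fin 2) F → X} {g : GL (Fin 2) F}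
    (hQ : ∀ g, T.Q (fun κ => Φ (g * integralGL F κ))) (h : T.EdgeCompat hp Φ g)
    {i : GL (Fin 2) (unitBallSubring F)} {c : unitBallSubring F} (hi : i 1 0 = p * c) :
    T.EdgeCompat hp Φ (g * integralGL F i) := by
  obtain ⟨i', hi', h00, h01, h10, h11⟩ := integralGL_mul_piGL hp hi
  have e1 : (fun κ => Φ (g * integralGL F i * piGL hp * integralGL F κ)) =
      fun κ => (fun κ' => Φ (g * piGL hp * integralGL F κ')) (i' * κ) := by
    funext κ
    simp only [map_mul]
    rw [mul_assoc g, hi', ← mul_assoc, ← mul_assoc]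
  have e2 : (fun κ => Φ (g * integralGL F i * integralGL F κ)) =
      fun κ => (fun κ' => Φ (g * integralGL F κ')) (i * κ) := by
    funext κ
    simp only [map_mul, mul_assoc]
  rw [EdgeCompat, e1, e2, T.top_mul _ _ _ (hQ _) h10, T.top_mul _ _ _ (hQ _) hi,
    T.bot_mul _ _ _ (hQ _) h10, T.bot_mul _ _ _ (hQ _) hi, h00, h01, h11, h.1, h.2]
  exact ⟨rfl, rfl⟩

theorem EdgeCompat.mul_piGL {hp : (p : F) ≠ 0} {Φ : GL (Fin 2) F → X} {g : GL (Fin 2) F}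
    (hΦ : ∀ g, Φ (scalarGL hp * g) = Φ g) (h : T.EdgeCompat hp Φ g) :
    T.EdgeCompat hp Φ (g * piGL hp) := by
  have e : (fun κ => Φ (g * piGL hp * piGL hp * integralGL F κ)) =
      fun κ => Φ (g * integralGL F κ) := by
    funext κ
    rw [mul_assoc g, piGL_mul_self, ← scalarGL_mul_comm, mul_assoc, hΦ]
  rw [EdgeCompat, e]
  exact ⟨h.2.symm, h.1.symm⟩

theorem eq_upperGL_mul_swapGL {R : Type*} [CommRing R] (κ : GL (Fin 2) R) (u : Rˣ)
    (hu : (u : R) = κ 1 0) :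
    ∃ i : GL (Fin 2) R, i 1 0 = 0 ∧ κ = upperGL (κ 0 0 * ↑u⁻¹) * swapGL 0 * i := by
  refine ⟨(upperGL (κ 0 0 * ↑u⁻¹) * swapGL 0)⁻¹ * κ, ?_, by rw [mul_inv_cancel_left]⟩
  have h : (upperGL (κ 0 0 * ↑u⁻¹))⁻¹ = upperGL (-(κ 0 0 * (↑u⁻¹ : R))) :=
    inv_eq_of_mul_eq_one_left (by rw [← upperGL_add, neg_add_cancel]; apply GL2_ext <;> simp)
  rw [_root_.mul_inv_rev, h]
  simp only [GL2_mul_apply, coe_swapGL_inv, ← hu]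
  simp

theorem exists_function (T : TreeData p (unitBallSubring F) X E) (hp : (p : F) ≠ 0)
    (hlt : ‖(p : F)‖ < 1) (hval : ∀ x : F, x ≠ 0 → ∃ n : ℤ, ‖x‖ = ‖(p : F)‖ ^ n)
    (hmax : ∀ x : unitBallSubring F, IsUnit x ∨ ∃ y, x = p * y) :
    ∃ Φ : GL (Fin 2) F → X, (∀ g, T.Q (fun κ => Φ (g * integralGL F κ))) ∧
      (∀ g, T.EdgeCompat hp Φ g) ∧ (∀ g, Φ (scalarGL hp * g) = Φ g) ∧
      ∀ κ, Φ (integralGL F κ) = T.root κ := by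
  obtain ⟨R, hR, hlink, hroot⟩ := T.exists_levels hp
  choose z n b κ hg using exists_affineGL_mul hp hval
  let Φ : GL (Fin 2) F → X := fun g => R (n g) (b g) (κ g)
  have hΦ : ∀ z' n' b' κ', Φ (affineGL hp z' n' b' * integralGL F κ') = R n' b' κ' := by
    intro z' n' b' κ'
    set g := affineGL hp z' n' b' * integralGL F κ' with hg'
    have h : affineGL hp z' n' b' * integralGL F (κ' * (κ g)⁻¹) = affineGL hp (z g) (n g) (b g) := by
      rw [map_mul, map_inv, ← mul_assoc, ← hg', mul_inv_eq_iff_eq_mul, ← hg g]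
    obtain ⟨-, h2, β, h3, h4⟩ := affineGL_inj hp hlt h
    change R (n g) (b g) (κ g) = _
    rw [← h2, h4, (hR n').2, ← h3, inv_mul_cancel_right]
  have hres : ∀ z' n' b', (fun κ => Φ (affineGL hp z' n' b' * integralGL F κ)) = R n' b' :=
    fun z' n' b' => funext fun κ => hΦ z' n' b' κ
  have hQ : ∀ g, T.Q (fun κ => Φ (g * integralGL F κ)) := by
    intro g
    have e : (fun κ' => Φ (g * integralGL F κ')) = fun κ' => R (n g) (b g) (κ g * κ') := by
      funext κ'
      conv_lhs => rw [hg g, mul_assoc, ← map_mul, hΦ]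
    rw [e]
    exact T.Q_mul _ _ ((hR _).1 _)
  have hinv : ∀ g, Φ (scalarGL hp * g) = Φ g := by
    intro g
    conv_lhs => rw [hg g, ← mul_assoc, scalarGL_mul_affineGL, hΦ]
  have hbase : ∀ z n b, T.EdgeCompat hp Φ (affineGL hp z n b * integralGL F (swapGL 0)) := by
    intro z n b
    have e : (fun κ => Φ (affineGL hp z n b * integralGL F (swapGL 0) * integralGL F κ)) =
        fun κ => R n b (swapGL 0 * κ) := by
      funext κ
      rw [mul_assoc, ← map_mul, hΦ]
    rw [EdgeCompat, e, affineGL_mul_swap_mul_piGL, hres]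
    exact hlink n b
  refine ⟨Φ, hQ, fun g => ?_, hinv, fun κ' => ?_⟩
  · rw [hg g]
    rcases hmax (κ g 1 0) with ⟨u, hu⟩ | ⟨c, hc⟩
    · obtain ⟨i, hi, hκ⟩ := eq_upperGL_mul_swapGL (κ g) u hu
      rw [hκ, map_mul, map_mul, ← mul_assoc, ← mul_assoc, affineGL_mul_upperGL]
      exact (hbase _ _ _).mul_integralGL hQ (c := 0) (by rw [hi, mul_zero])
    · refine EdgeCompat.mul_integralGL hQ ?_ hc
      rw [← sub_add_cancel (n g) 1, ← affineGL_mul_swap_mul_piGL]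
      exact (hbase _ _ _).mul_piGL hinv
  · have h1 : affineGL hp 0 0 0 = 1 := by
      apply GL2_ext <;> simp
    have := hΦ 0 0 0 κ'
    rwa [h1, one_mul, hroot] at this

end TreeData

/-- The right regular representation on functions. -/
def rightRegular (k G : Type*) [Field k] [Group G] : Representation k G (G → k) where
  toFun x := { toFun := fun φ g => φ (g * x), map_add' := fun _ _ => rfl, map_smul' := fun _ _ => rfl }
  map_one' := by ext φ g; simp
  map_mul' x y := by
    apply LinearMap.ext; intro φ; funext g; simp [mul_assoc]

theorem rightRegular_apply {k G : Type*} [Field k] [Group G] (x : G) (φ : G → k) (g : G) :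
    rightRegular k G x φ g = φ (g * x) := rfl

/-- The left ideal of elements annihilating a vector of a representation. -/
def annihilatorIdeal {k G V : Type*} [Field k] [Group G] [AddCommGroup V] [Module k V]
    (σ : Representation k G V) (v : V) : Ideal (MonoidAlgebra k G) where
  carrier := {a | σ.asAlgebraHom a v = 0}
  add_mem' := by
    intro a b ha hb
    simp only [Set.mem_ofPred_eq] at *
    rw [map_add, LinearMap.add_apply, ha, hb, add_zero]
  zero_mem' := by simp
  smul_mem' := by
    intro c a ha
    simp only [Set.mem_ofPred_eq, smul_eq_mul] at *
    rw [map_mul, Module.End.mul_apply, ha, map_zero]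

theorem mem_annihilatorIdeal {k G V : Type*} [Field k] [Group G] [AddCommGroup V] [Module k V]
    {σ : Representation k G V} {v : V} {a : MonoidAlgebra k G} :
    a ∈ annihilatorIdeal σ v ↔ σ.asAlgebraHom a v = 0 := Iff.rfl

/-- The representation on the quotient of the group algebra by a left ideal. -/
noncomputable def quotientRep {k G : Type*} [Field k] [Group G] (m : Ideal (MonoidAlgebra k G)) :
    Representation k G (MonoidAlgebra k G ⧸ m) :=
  (Algebra.lsmul (A := MonoidAlgebra k G) k k (MonoidAlgebra k G ⧸ m)).toMonoidHom.comp
    (MonoidAlgebra.of k G)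

theorem quotientRep_mk {k G : Type*} [Field k] [Group G] (m : Ideal (MonoidAlgebra k G)) (g : G)
    (a : MonoidAlgebra k G) :
    quotientRep m g (Submodule.Quotient.mk a) =
      Submodule.Quotient.mk (MonoidAlgebra.of k G g * a) := rfl

theorem quotientRep_eq_of_mem {k G : Type*} [Field k] [Group G] (m : Ideal (MonoidAlgebra k G))
    (W : Submodule k (MonoidAlgebra k G ⧸ m)) (hW : ∀ g : G, ∀ v ∈ W, quotientRep m g v ∈ W)
    (hm : m.IsMaximal) : W = ⊥ ∨ W = ⊤ := by
  have hsm : ∀ (a : MonoidAlgebra k G) (v) (_ : v ∈ W), a • v ∈ W := by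
    intro a v hv
    induction a using MonoidAlgebra.induction_on with
    | of g => exact hW g v hv
    | add a b ha hb => rw [add_smul]; exact W.add_mem ha hb
    | smul r a ha => rw [smul_assoc]; exact W.smul_mem r ha
  let W' : Submodule (MonoidAlgebra k G) (MonoidAlgebra k G ⧸ m) :=
    { W.toAddSubmonoid with smul_mem' := fun a v hv => hsm a v hv }
  have : IsSimpleModule (MonoidAlgebra k G) (MonoidAlgebra k G ⧸ m) :=
    isSimpleModule_iff_isCoatom.2 hm.out
  rcases eq_bot_or_eq_top W' with h | h
  · left
    ext v
    change v ∈ W' ↔ v = 0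
    rw [h, Submodule.mem_bot]
  · right
    ext v
    change v ∈ W' ↔ v ∈ (⊤ : Submodule k _)
    simp [h]

theorem exists_irreducible_quotient_of_sequence {G : Type} [Group G] [TopologicalSpace G]
    [IsTopologicalGroup G] {k : Type} [Field k] (U : Subgroup G)
    (hUo : IsOpen (U : Set G)) (hUc : IsCompact (U : Set G)) (z : G) (hz : ∀ g, z * g = g * z)
    (e : ℕ → G → k) (he : e 0 ≠ 0)
    (heU : ∀ i, ∀ u ∈ U, rightRegular k G u (e i) = e i)
    (hez : rightRegular k G z (e 0) = e 0) (A B : MonoidAlgebra k G)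
    (hA : ∀ i, (rightRegular k G).asAlgebraHom A (e i) = e (i + 1))
    (hB0 : (rightRegular k G).asAlgebraHom B (e 0) = 0)
    (hB : ∀ i, (rightRegular k G).asAlgebraHom B (e (i + 1)) = e i) :
    ∃ (V : Type) (_ : AddCommGroup V) (_ : Module k V) (ρ : Representation k G V),
      (∀ v : V, IsOpen {g : G | ρ g v = v}) ∧ Nontrivial V ∧
      (∀ W : Submodule k V, (∀ (g : G), ∀ v ∈ W, ρ g v ∈ W) → W = ⊥ ∨ W = ⊤) ∧
      ¬ (∀ H : Subgroup G, IsOpen (H : Set G) → IsCompact (H : Set G) →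
          FiniteDimensional k (Representation.invariants (ρ.comp H.subtype))) ∧
      (∀ v : V, ρ z v = v) := by
  set σ := (rightRegular k G).asAlgebraHom with hσ
  have hof : ∀ x, σ (MonoidAlgebra.of k G x) = rightRegular k G x := fun x => by
    rw [hσ, Representation.asAlgebraHom_of]
  have hne : annihilatorIdeal (rightRegular k G) (e 0) ≠ ⊤ := by
    rw [Ideal.ne_top_iff_one, mem_annihilatorIdeal, map_one]
    exact he
  obtain ⟨m, hm, hJm⟩ := Ideal.exists_le_maximal _ hne
  have hmem : ∀ a, σ a (e 0) = 0 → a ∈ m := fun a ha => hJm ha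
  have hApow : ∀ i, σ (A ^ i) (e 0) = e i := by
    intro i
    induction i with
    | zero => simp
    | succ i ih => rw [pow_succ', map_mul, Module.End.mul_apply, ih, hA]
  have hBpow : ∀ n, ∀ i < n, σ (B ^ n) (e i) = 0 := by
    intro n
    induction n with
    | zero => simp
    | succ n ih =>
      intro i hi
      rw [pow_succ, map_mul, Module.End.mul_apply]
      cases i with
      | zero => rw [hB0, map_zero]
      | succ i => rw [hB]; exact ih i (by omega)
  have hBpow' : ∀ n, σ (B ^ n) (e n) = e 0 := by
    intro n
    induction n with
    | zero => simp
    | succ n ih => rw [pow_succ, map_mul, Module.End.mul_apply, hB, ih]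
  have hfix : ∀ i, ∀ u ∈ U, quotientRep m u (Submodule.Quotient.mk (A ^ i)) =
      Submodule.Quotient.mk (A ^ i) := by
    intro i u hu
    rw [quotientRep_mk, Submodule.Quotient.eq]
    apply hmem
    rw [map_sub, map_mul, LinearMap.sub_apply, Module.End.mul_apply, hApow, hof, heU i u hu,
      sub_self]
  have h1 : (Submodule.Quotient.mk (1 : MonoidAlgebra k G) : MonoidAlgebra k G ⧸ m) ≠ 0 := by
    rw [Ne, Submodule.Quotient.mk_eq_zero]
    exact (Ideal.ne_top_iff_one m).1 hm.ne_top
  classical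
  refine ⟨MonoidAlgebra k G ⧸ m, inferInstance, inferInstance, quotientRep m, ?_, ⟨_, _, h1⟩,
    fun W hW => quotientRep_eq_of_mem m W hW hm, ?_, ?_⟩
  · intro v
    let S : Subgroup G :=
      { carrier := {g | quotientRep m g v = v}
        mul_mem' := by
          intro a b ha hb
          simp only [Set.mem_ofPred_eq] at *
          rw [map_mul, Module.End.mul_apply, hb, ha]
        one_mem' := by simp
        inv_mem' := by
          intro a ha
          simp only [Set.mem_ofPred_eq] at *
          nth_rewrite 1 [← ha]
          rw [← Module.End.mul_apply, ← map_mul]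
          simp }
    change IsOpen (S : Set G)
    apply Subgroup.isOpen_of_mem_nhds (g := 1)
    change ∀ᶠ g in nhds (1 : G), quotientRep m g v = v
    obtain ⟨a, rfl⟩ := Submodule.Quotient.mk_surjective _ v
    induction a using MonoidAlgebra.induction_on with
    | of x =>
      have hc : Filter.Tendsto (fun g : G => x⁻¹ * g * x) (nhds 1) (nhds 1) := by
        have : Continuous (fun g : G => x⁻¹ * g * x) := by fun_prop
        simpa using this.tendsto 1
      filter_upwards [hc (hUo.mem_nhds U.one_mem)] with g hg
      have := congrArg (quotientRep m x) (hfix 0 _ hg)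
      rw [← Module.End.mul_apply, ← map_mul] at this
      rw [pow_zero, quotientRep_mk, quotientRep_mk] at this
      rw [quotientRep_mk, ← map_mul]
      convert this using 3 <;> simp [mul_assoc]
    | add a b ha hb =>
      filter_upwards [ha, hb] with g h1 h2
      rw [Submodule.Quotient.mk_add, map_add, h1, h2]
    | smul r a ha =>
      filter_upwards [ha] with g h1
      rw [Submodule.Quotient.mk_smul, map_smul, h1]
  · intro h
    have hfin := h U hUo hUc
    let w : ℕ → Representation.invariants ((quotientRep m).comp U.subtype) :=
      fun i => ⟨Submodule.Quotient.mk (A ^ i), fun u => hfix i u.1 u.2⟩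
    have hli : LinearIndependent k w := by
      rw [linearIndependent_iff']
      intro s c hc
      by_contra hcon
      push Not at hcon
      obtain ⟨i, hi, hci⟩ := hcon
      have hne : (s.filter (fun i => c i ≠ 0)).Nonempty := ⟨i, by simp [hi, hci]⟩
      set n := (s.filter (fun i => c i ≠ 0)).max' hne with hn
      have hnm := Finset.max'_mem _ hne
      rw [← hn] at hnm
      rw [Finset.mem_filter] at hnm
      have hc' : (Submodule.Quotient.mk (∑ i ∈ s, c i • A ^ i) : MonoidAlgebra k G ⧸ m) = 0 := by
        have := congrArg Subtype.val hc
        rw [← Submodule.mkQ_apply, map_sum]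
        simpa [w] using this
      rw [Submodule.Quotient.mk_eq_zero] at hc'
      have h2 : B ^ n * (∑ i ∈ s, c i • A ^ i) ∈ m := m.smul_mem _ hc'
      have h3 : B ^ n * (∑ i ∈ s, c i • A ^ i) - c n • 1 ∈ m := by
        apply hmem
        rw [map_sub, map_mul, LinearMap.sub_apply, Module.End.mul_apply, map_sum,
          LinearMap.sum_apply, map_sum, Finset.sum_eq_single n]
        · rw [map_smul, LinearMap.smul_apply, hApow, map_smul, hBpow', map_smul, map_one]
          simp
        · intro j hj hjn
          by_cases hcj : c j = 0
          · simp [hcj]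
          · rw [map_smul, LinearMap.smul_apply, hApow, map_smul, hBpow, smul_zero]
            exact lt_of_le_of_ne (Finset.le_max' _ _ (by simp [hj, hcj])) hjn
        · intro hh; exact absurd hnm.1 hh
      have h4 : c n • (1 : MonoidAlgebra k G) ∈ m := by
        have := m.sub_mem h2 h3
        rwa [sub_sub_cancel] at this
      have h5 : (1 : MonoidAlgebra k G) ∈ m := by
        have := Submodule.smul_of_tower_mem m (c n)⁻¹ h4
        rwa [smul_smul, inv_mul_cancel₀ hnm.2, one_smul] at this
      exact (Ideal.ne_top_iff_one m).1 hm.ne_top h5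
    have := hli.finite
    exact not_finite ℕ
  · intro v
    obtain ⟨a, rfl⟩ := Submodule.Quotient.mk_surjective _ v
    rw [quotientRep_mk, Submodule.Quotient.eq]
    have hcomm : MonoidAlgebra.of k G z * a = a * MonoidAlgebra.of k G z := by
      induction a using MonoidAlgebra.induction_on with
      | of x => rw [← map_mul, ← map_mul, hz]
      | add a b ha hb => rw [mul_add, add_mul, ha, hb]
      | smul r a ha => rw [mul_smul_comm, smul_mul_assoc, ha]
    rw [hcomm, ← mul_sub_one]
    apply m.smul_mem
    apply hmem
    rw [map_sub, LinearMap.sub_apply, hof, hez, map_one]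
    simp

namespace ResidueData

variable {p : ℕ} {O 𝔽 k : Type*} [CommRing O] [Field 𝔽] [Fintype 𝔽] [Field k]
  (D : ResidueData p O 𝔽 k) {M : Type*} [AddCommGroup M] [Module k M]

/-- The tree data attached to the two maps `ψ` and a vector `C`. -/
noncomputable def treeData (hp : 3 ≤ p) [Fact p.Prime] (ψ : Bool → M →ₗ[k] M) (C : M) :
    TreeData p O (M × EdgeVal M) (EdgeVal M) :=
  have hzero : (fun _ => (0, ⟨0, 0, 0⟩)) = D.rootFun (0 : M) := by
    funext κ
    simp [rootFun, vform]
  { Q := D.VertexCond ψ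
    top := D.topEdge
    bot := botEdge
    act := D.act
    ext := D.ext ψ
    root := D.rootFun C
    zero := (0, ⟨0, 0, 0⟩)
    Q_mul := fun _ i h => h.left_mul i
    top_mul := fun _ _ _ h hi => h.topEdge_mul hp hi
    bot_mul := fun _ _ _ h hi => h.botEdge_mul hi
    Q_ext := vertexCond_ext hp ψ
    top_ext := topEdge_ext hp ψ
    bot_ext := botEdge_ext ψ
    Q_root := vertexCond_rootFun ψ C
    Q_zero := hzero ▸ vertexCond_rootFun ψ 0
    top_root := by rw [hzero, topEdge_rootFun hp, topEdge_rootFun hp]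
    bot_root := by rw [hzero, topEdge_rootFun hp, botEdge_rootFun]
    bot_zero := by rw [hzero, topEdge_rootFun hp, botEdge_rootFun] }

end ResidueData

section Construction

variable {p : ℕ} {F 𝔽 k : Type*} [NormedField F] [IsUltrametricDist F] [Field 𝔽] [Fintype 𝔽]
  [Field k] (D : ResidueData p (unitBallSubring F) 𝔽 k) {M : Type*} [AddCommGroup M] [Module k M]

/-- The matrices occurring in the operator attached to the pair of an embedding. -/
noncomputable def hopGL (hp : (p : F) ≠ 0) (x y ν : 𝔽) : GL (Fin 2) F :=
  piGL hp * integralGL F (swapGL (D.rep x)) * (piGL hp)⁻¹ * integralGL F (swapGL (D.rep y)) *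
    (piGL hp)⁻¹ * integralGL F (lowerGL (D.lift ν))

/-- The element of the group algebra inducing `ψ j`. -/
noncomputable def hopElement (hp : (p : F) ≠ 0) (j : Bool) : MonoidAlgebra k (GL (Fin 2) F) :=
  ∑ x, ∑ y, ∑ ν, MonoidAlgebra.single (hopGL D hp x y ν)
    (-(D.emb j x * D.emb j ν ^ (p ^ 2 - 2)))

theorem exists_equivariant_function (hp3 : 3 ≤ p) [Fact p.Prime] (hp : (p : F) ≠ 0)
    (hlt : ‖(p : F)‖ < 1) (hval : ∀ x : F, x ≠ 0 → ∃ n : ℤ, ‖x‖ = ‖(p : F)‖ ^ n)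
    (ψ : Bool → M →ₗ[k] M) (C : M) :
    ∃ φ : GL (Fin 2) F → M, (∀ g, φ (scalarGL hp * g) = φ g) ∧
      (∀ g, ∃ A B C, ∀ κ, φ (g * integralGL F κ) = D.vform (κ 0 0) (κ 1 0) A B C) ∧
      φ (integralGL F (swapGL 0)) = C ∧
      ∀ j g, ψ j (φ g) =
        ∑ x, ∑ y, ∑ ν, (-(D.emb j x * D.emb j ν ^ (p ^ 2 - 2))) • φ (g * hopGL D hp x y ν) := by
  have hmax : ∀ x : unitBallSubring F, IsUnit x ∨ ∃ y, x = p * y := fun x => by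
    rw [D.isUnit_iff, ← D.red_eq_zero]; tauto
  obtain ⟨Φ, hQ, hE, hinv, hroot⟩ := (D.treeData hp3 ψ C).exists_function hp hlt hval hmax
  refine ⟨fun g => (Φ g).1, fun g => congrArg Prod.fst (hinv g), fun g => (hQ g).form, ?_, fun j g => ?_⟩
  · change (Φ _).1 = _
    rw [hroot]
    simp [ResidueData.treeData, ResidueData.rootFun, ResidueData.vform]
  have hbot : ∀ g, (Φ (g * piGL hp)).2 = D.topEdge (fun κ => Φ (g * integralGL F κ)) := fun g => by
    have := (hE g).2
    change (Φ (g * piGL hp * integralGL F 1)).2 = _ at this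
    rwa [map_one, mul_one] at this
  have hA : ∀ g, (Φ (g * piGL hp)).2.A = (Φ g).1 := fun g => by
    rw [hbot, ResidueData.topEdge, map_one, mul_one]
  have hB : ∀ g, (Φ g).2.B j = -∑ ν, D.emb j ν ^ (p ^ 2 - 2) •
      (Φ (g * (piGL hp)⁻¹ * integralGL F (lowerGL (D.lift ν)))).1 := fun g => by
    conv_lhs => rw [← inv_mul_cancel_right g (piGL hp), hbot]
    rfl
  have hW : ∀ g, (Φ g).2.W j = ∑ y, (Φ (g * (piGL hp)⁻¹ *
      integralGL F (swapGL (D.rep y)))).2.B j := fun g => by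
    conv_lhs => rw [← inv_mul_cancel_right g (piGL hp), hbot]
    rfl
  have hsum := (hQ (g * piGL hp)).sum_W 1 j
  simp only [one_mul, map_one, mul_one] at hsum
  change ψ j (Φ g).1 = _
  rw [← hA, ← hsum]
  simp only [hW, hB, Finset.smul_sum, smul_neg, smul_smul, neg_smul, hopGL, mul_assoc,
    ← Finset.sum_neg_distrib]

end Construction

theorem isOpen_congruence_aux {F : Type*} [NormedField F] :
    IsOpen {g : GL (Fin 2) F | ∀ i j, ‖g i j - (1 : Matrix (Fin 2) (Fin 2) F) i j‖ < 1} := by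
  simp only [Set.ofPred_forall]
  refine isOpen_iInter_of_finite fun i => isOpen_iInter_of_finite fun j => ?_
  have hc : Continuous fun g : GL (Fin 2) F => g i j :=
    (Units.continuous_val).matrix_elem i j
  exact isOpen_lt (hc.sub continuous_const).norm continuous_const

theorem isCompact_integral {F : Type*} [NormedField F] [ProperSpace F] :
    IsCompact {g : GL (Fin 2) F | (∀ i j, ‖g i j‖ ≤ 1) ∧ ∀ i j, ‖g⁻¹ i j‖ ≤ 1} := by
  let B : Set (Matrix (Fin 2) (Fin 2) F) := {A | ∀ i j, ‖A i j‖ ≤ 1}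
  have hB : IsCompact B := by
    have : B = Set.pi Set.univ fun _ => Set.pi Set.univ fun _ => Metric.closedBall (0 : F) 1 := by
      ext A
      exact ⟨fun h i _ j _ => mem_closedBall_zero_iff.2 (h i j),
        fun h i j => mem_closedBall_zero_iff.1 (h i trivial j trivial)⟩
    rw [this]
    exact isCompact_univ_pi fun _ => isCompact_univ_pi fun _ => isCompact_closedBall _ _
  have hB' := hB.prod (hB.image MulOpposite.continuous_op)
  have := (Units.isClosedEmbedding_embedProduct (α := Matrix (Fin 2) (Fin 2) F)).isCompact_preimage
    hB'
  convert this using 1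
  ext g
  constructor
  · rintro ⟨h1, h2⟩
    exact ⟨h1, _, h2, rfl⟩
  · rintro ⟨h1, x, h2, h3⟩
    have h4 : x = (g⁻¹ : GL (Fin 2) F) := MulOpposite.op_injective h3
    exact ⟨h1, h4 ▸ h2⟩

/-- The principal congruence subgroup. -/
noncomputable def congruenceSubgroup (F : Type*) [NormedField F] [IsUltrametricDist F] :
    Subgroup (GL (Fin 2) F) :=
  (Matrix.GeneralLinearGroup.map (n := Fin 2) (reduction F)).ker.map (integralGL F)

theorem isOpen_congruenceSubgroup (F : Type*) [NormedField F] [IsUltrametricDist F] :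
    IsOpen (congruenceSubgroup F : Set (GL (Fin 2) F)) := by
  refine Subgroup.isOpen_of_mem_nhds _ (g := 1) ?_
  refine Filter.mem_of_superset (isOpen_congruence_aux.mem_nhds (by simp)) ?_
  intro g hg
  have h1 : ∀ i j, ‖g i j‖ ≤ 1 := by
    intro i j
    have h2 : ‖(1 : Matrix (Fin 2) (Fin 2) F) i j‖ ≤ 1 := by
      rw [Matrix.one_apply]; split_ifs <;> simp
    rw [← sub_add_cancel (g i j) ((1 : Matrix (Fin 2) (Fin 2) F) i j)]
    exact (IsUltrametricDist.norm_add_le_max _ _).trans (max_le (hg i j).le h2)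
  have h00 := hg 0 0
  have h01 := hg 0 1
  have h10 := hg 1 0
  have h11 := hg 1 1
  simp only [ne_eq, Fin.isValue, one_apply_eq, zero_ne_one, one_ne_zero, not_false_eq_true,
    one_apply_ne, sub_zero] at h00 h01 h10 h11
  let A : Matrix (Fin 2) (Fin 2) (unitBallSubring F) := fun i j => ⟨g i j, h1 i j⟩
  have hA : A.map (reduction F) = 1 := by
    ext i j
    rw [Matrix.map_apply, ← sub_eq_zero]
    have : (1 : Matrix (Fin 2) (Fin 2) (ResidueOf F)) i j =
        reduction F ((1 : Matrix (Fin 2) (Fin 2) (unitBallSubring F)) i j) := by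
      simp only [Matrix.one_apply]; split_ifs <;> simp
    rw [this, ← map_sub, reduction_eq_zero]
    convert hg i j
    simp only [A, Matrix.one_apply]
    split_ifs <;> simp
  have hdet : IsUnit A.det := by
    rw [isUnit_unitBallSubring_iff]
    refine le_antisymm A.det.2 (not_lt.1 fun h => ?_)
    rw [← reduction_eq_zero, RingHom.map_det] at h
    change (A.map (reduction F)).det = 0 at h
    rw [hA, Matrix.det_one] at h
    exact one_ne_zero h
  refine ⟨Matrix.GeneralLinearGroup.mk'' A hdet, ?_, GL2_ext rfl rfl rfl rfl⟩
  refine (MonoidHom.mem_ker).2 (Units.ext hA)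

theorem isCompact_congruenceSubgroup (F : Type*) [NormedField F] [IsUltrametricDist F]
    [ProperSpace F] : IsCompact (congruenceSubgroup F : Set (GL (Fin 2) F)) := by
  refine isCompact_integral.of_isClosed_subset
    (Subgroup.isClosed_of_isOpen _ (isOpen_congruenceSubgroup F)) ?_
  rintro _ ⟨κ, -, rfl⟩
  refine ⟨fun i j => (κ i j).2, fun i j => ?_⟩
  rw [← map_inv]
  exact (κ⁻¹ i j).2

section ResidueDataOfPadic

variable {p : ℕ} [Fact p.Prime] {F : Type*} [NormedField F] [NormedAlgebra ℚ_[p] F]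
  [IsUltrametricDist F]

theorem prime_ne_zero_of_padic (p : ℕ) [Fact p.Prime] (F : Type*) [NormedField F]
    [NormedAlgebra ℚ_[p] F] : (p : F) ≠ 0 := by
  rw [← norm_ne_zero_iff, norm_prime_eq p F]
  have : (p : ℝ) ≠ 0 := Nat.cast_ne_zero.2 (Fact.out : p.Prime).ne_zero
  exact inv_ne_zero this

theorem norm_lt_one_iff_exists (hval : ∀ x : F, x ≠ 0 → ∃ n : ℤ, ‖x‖ = ‖(p : F)‖ ^ n)
    (x : unitBallSubring F) : ‖(x : F)‖ < 1 ↔ ∃ y, x = p * y := by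
  have hlt := norm_prime_lt_one p F
  have hp := prime_ne_zero_of_padic p F
  have hpos : 0 < ‖(p : F)‖ := norm_pos_iff.2 hp
  constructor
  · intro h
    by_cases h0 : (x : F) = 0
    · exact ⟨0, by rw [mul_zero]; exact Subtype.ext h0⟩
    obtain ⟨n, hn⟩ := hval _ h0
    rw [hn] at h
    have h1 : 0 < n := by
      by_contra hneg
      exact absurd h (not_lt.2 (one_le_zpow_of_nonpos₀ hpos hlt.le (not_lt.1 hneg)))
    have h2 : ‖(x : F) / p‖ ≤ 1 := by
      rw [norm_div, hn, div_eq_mul_inv, ← zpow_sub_one₀ hpos.ne']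
      obtain ⟨m, hm⟩ := Int.eq_ofNat_of_zero_le (show 0 ≤ n - 1 by omega)
      rw [hm, zpow_natCast]
      exact pow_le_one₀ hpos.le hlt.le
    refine ⟨⟨(x : F) / p, h2⟩, Subtype.ext ?_⟩
    push_cast
    field_simp
  · rintro ⟨y, rfl⟩
    push_cast
    rw [norm_mul]
    exact mul_lt_one_of_nonneg_of_lt_one_left (norm_nonneg _) hlt y.2

/-- The residue data of the unramified quadratic extension. -/
theorem exists_residueData [FiniteDimensional ℚ_[p] F] (hdeg : Module.finrank ℚ_[p] F = 2)
    {ζ : F} (hζ : IsPrimitiveRoot ζ (p ^ 2 - 1)) (k : Type*) [Field k] [IsAlgClosed k]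
    [CharP k p] : ∃ _ : Fintype (ResidueOf F),
      ∃ D : ResidueData p (unitBallSubring F) (ResidueOf F) k, D.red = reduction F := by
  obtain ⟨hfin, hcard⟩ := residue_card hdeg hζ
  have hF := Fintype.ofFinite (ResidueOf F)
  rw [Nat.card_eq_fintype_card] at hcard
  have := residue_charP p F
  let := ZMod.algebra (ResidueOf F) p
  let := ZMod.algebra k p
  let f : ResidueOf F →+* k := (IsAlgClosed.lift : ResidueOf F →ₐ[ZMod p] k).toRingHom
  refine ⟨hF, {
    red := reduction F
    red_surjective := Ideal.Quotient.mk_surjective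
    red_eq_zero := fun x => by
      rw [reduction_eq_zero]
      exact norm_lt_one_iff_exists (fun x hx => exists_norm_eq_zpow hdeg hζ hx) x
    isUnit_iff := fun x => by
      rw [isUnit_unitBallSubring_iff, Ne, reduction_eq_zero, not_lt]
      exact ⟨fun h => h.ge, fun h => le_antisymm x.2 h⟩
    mul_cancel := fun x y h => by
      have h1 := congrArg (Subtype.val) h
      push_cast at h1
      exact Subtype.ext (mul_left_cancel₀ (prime_ne_zero_of_padic p F) h1)
    emb := fun j => if j then (frobenius k p).comp f else f
    emb_pow := fun j x => ?_
    card_eq := hcard }, rfl⟩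
  cases j
  · simp [frobenius_def]
  · simp only [Bool.not_true, if_true, Bool.false_eq_true, if_false, RingHom.comp_apply,
      frobenius_def]
    rw [← pow_mul, ← sq, ← hcard, ← map_pow, FiniteField.pow_card]

end ResidueDataOfPadic

theorem ResidueData.vform_eq_of_mem_ker {p : ℕ} {O 𝔽 k M : Type*} [CommRing O] [Field 𝔽]
    [Fintype 𝔽] [Field k] [AddCommGroup M] [Module k M] (D : ResidueData p O 𝔽 k)
    {κ : GL (Fin 2) O} (hκ : κ ∈ (GeneralLinearGroup.map (n := Fin 2) D.red).ker)
    (A : M) (B : Bool → M) (C : M) : D.vform (κ 0 0) (κ 1 0) A B C = A := by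
  rw [MonoidHom.mem_ker] at hκ
  have h0 : D.red (κ 0 0) = 1 := by simpa using congrArg (fun g : GL (Fin 2) 𝔽 => g 0 0) hκ
  have h1 : D.red (κ 1 0) = 0 := by simpa using congrArg (fun g : GL (Fin 2) 𝔽 => g 1 0) hκ
  simp [ResidueData.vform, ResidueData.ι_apply, h0, h1]

section Assembly

variable {p : ℕ} {F 𝔽 k : Type*} [NormedField F] [IsUltrametricDist F] [Field 𝔽] [Fintype 𝔽]
  [Field k] (D : ResidueData p (unitBallSubring F) 𝔽 k)

theorem asAlgebraHom_hopElement (hp : (p : F) ≠ 0) (j : Bool) (e : GL (Fin 2) F → k)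
    (g : GL (Fin 2) F) : (rightRegular k (GL (Fin 2) F)).asAlgebraHom (hopElement D hp j) e g =
      ∑ x, ∑ y, ∑ ν, (-(D.emb j x * D.emb j ν ^ (p ^ 2 - 2))) * e (g * hopGL D hp x y ν) := by
  simp [hopElement, map_sum, Representation.asAlgebraHom_single, rightRegular_apply]

/-- The two shifts on sequences. -/
def shiftMaps (k : Type*) [Field k] : Bool → (ℕ → k) →ₗ[k] (ℕ → k)
  | false => { toFun := fun u i => u (i + 1)
               map_add' := fun _ _ => rfl
               map_smul' := fun _ _ => rfl }
  | true => { toFun := fun u i => Nat.casesOn i 0 u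
              map_add' := fun _ _ => by funext i; cases i <;> simp
              map_smul' := fun _ _ => by funext i; cases i <;> simp }

end Assembly

/-- For an odd prime `p`, with `F` the unramified quadratic extension of
`ℚ_p` and `k` an algebraic closure of `𝔽_p`, there exists a smooth irreducible
non-admissible `k`-linear representation of `G = GL₂(F)` on which the central element
`p·Id` (the scalar matrix with diagonal entries `p`) acts trivially. -/
theorem exists_smooth_irreducible_nonadmissible_central_p_trivial
    (p : ℕ) [Fact p.Prime] (hp : Odd p)
    (F : Type) [NormedField F] [NormedAlgebra ℚ_[p] F] [FiniteDimensional ℚ_[p] F]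
    (hdeg : Module.finrank ℚ_[p] F = 2)
    (hunram : ∃ ζ : F, IsPrimitiveRoot ζ (p ^ 2 - 1)) :
    ∃ (V : Type) (_ : AddCommGroup V) (_ : Module (AlgebraicClosure (ZMod p)) V)
      (ρ : Representation (AlgebraicClosure (ZMod p)) (GL (Fin 2) F) V),
      -- smooth: every vector has open stabilizer
      (∀ v : V, IsOpen {g : GL (Fin 2) F | ρ g v = v}) ∧
      -- irreducible: nonzero, and the only G-stable subspaces are 0 and V
      Nontrivial V ∧
      (∀ W : Submodule (AlgebraicClosure (ZMod p)) V,
        (∀ (g : GL (Fin 2) F), ∀ v ∈ W, ρ g v ∈ W) → W = ⊥ ∨ W = ⊤) ∧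
      -- non-admissible
      ¬ (∀ H : Subgroup (GL (Fin 2) F), IsOpen (H : Set (GL (Fin 2) F)) →
          IsCompact (H : Set (GL (Fin 2) F)) →
          FiniteDimensional (AlgebraicClosure (ZMod p))
            (Representation.invariants (ρ.comp H.subtype))) ∧
      -- the central element p·Id acts as the identity
      (∀ g : GL (Fin 2) F,
        (g : Matrix (Fin 2) (Fin 2) F) = (p : F) • (1 : Matrix (Fin 2) (Fin 2) F) →
        ∀ v : V, ρ g v = v) := by
  obtain ⟨ζ, hζ⟩ := hunram
  have := isUltrametricDist_of_padic p F
  have hpF := prime_ne_zero_of_padic p F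
  have hp3 : 3 ≤ p := by
    have := (Fact.out : p.Prime).two_le
    obtain ⟨m, rfl⟩ := hp
    omega
  have : ProperSpace F := FiniteDimensional.proper ℚ_[p] F
  obtain ⟨_, D, hD⟩ := exists_residueData hdeg hζ (AlgebraicClosure (ZMod p))
  obtain ⟨φ, hφz, hφU, hφs, hφ⟩ := exists_equivariant_function D hp3 hpF (norm_prime_lt_one p F)
    (fun x hx => exists_norm_eq_zpow hdeg hζ hx) (shiftMaps (AlgebraicClosure (ZMod p)))
    (Pi.single 0 1)
  have hop : ∀ j i g, (rightRegular (AlgebraicClosure (ZMod p)) (GL (Fin 2) F)).asAlgebraHom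
      (hopElement D hpF j) (fun g => φ g i) g =
        shiftMaps (AlgebraicClosure (ZMod p)) j (φ g) i := by
    intro j i g
    rw [asAlgebraHom_hopElement, hφ]
    simp only [Finset.sum_apply, Pi.smul_apply, smul_eq_mul]
  obtain ⟨V, i1, i2, ρ, h1, h2, h3, h4, h5⟩ := exists_irreducible_quotient_of_sequence
    (congruenceSubgroup F) (isOpen_congruenceSubgroup F) (isCompact_congruenceSubgroup F)
    (scalarGL hpF) (scalarGL_mul_comm hpF) (fun i g => φ g i)
    (fun h => one_ne_zero (α := AlgebraicClosure (ZMod p)) (by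
      have := congrFun h (integralGL F (swapGL 0))
      simp [hφs] at this))
    (fun i u hu => by
      obtain ⟨κ, hκ, rfl⟩ := hu
      funext g
      obtain ⟨A, B, C, h⟩ := hφU g
      have h1 := h 1
      rw [map_one, mul_one] at h1
      rw [rightRegular_apply, h κ, h1, D.vform_eq_of_mem_ker (hD ▸ hκ)]
      simp [ResidueData.vform])
    (by
      funext g
      rw [rightRegular_apply, ← scalarGL_mul_comm, hφz])
    (hopElement D hpF false) (hopElement D hpF true)
    (fun i => funext fun g => hop false i g) (funext fun g => hop true 0 g)
    (fun i => funext fun g => hop true (i + 1) g)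
  refine ⟨V, i1, i2, ρ, h1, h2, h3, h4, fun g hg => ?_⟩
  have : g = scalarGL hpF := by
    apply Units.ext
    rw [hg]
    ext i j
    fin_cases i <;> fin_cases j <;> simp
  rw [this]
  exact h5
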